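/- Let d ≥ 3, let η > 0 be a sufficiently small constant, let κ ≥ 1, and let L be sufficiently large with 1 ≤ λ ≤ (log L)⁴. Suppose Φ : ℝ × ℝ^d × ℝ^d → ℂ satisfies sup_{s,x,y} |∂_x^α ∂_y^β Φ(s,x,y)| ≤ D for all multi-indices |α|, |β| ≤ 10d and is supported in {|s| ≤ κL}. Then, with C = C(d, η, κ, χ₀), uniformly in (a, b) ∈ ℝ^{2d} and (ξ, ζ) ∈ ℝ^{2d}: ∫_ℝ | ∑_{(g,h) ∈ ℤ^d × ℤ^d, (g,h) ≠ 0} ∫_{ℝ^{2d}} χ₀((x−a)/λ) χ₀((y−b)/λ) Φ(s,x,y) e((Lg+ξ)·x + (Lh+ζ)·y + s(x·y)) dx dy | ds ≤ C·D·λ^{2d}·L^{−1+2η}·(1 + |ξ| + |ζ|). In particular, the same integral with the sum extended over all (g,h) ∈ ℤ^d × ℤ^d (including (g,h) = (0,0)) is at most C·D·λ^{2d}, uniformly in (ξ, ζ, a, b) ∈ ℝ^{4d}. -/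

import Mathlib

open MeasureTheory
open scoped RealInnerProductSpace ENNReal NNReal BigOperators

noncomputable section

/-- `e(z) = e^{2πiz}`. -/
def efun (t : ℝ) : ℂ := Complex.exp (2 * (Real.pi : ℂ) * Complex.I * (t : ℂ))

/-- Product cutoff `χ₀(z) = χ₀(z¹)⋯χ₀(z^d)` on `ℝ^d`. -/
def cutoffProd (d : ℕ) (χ : ℝ → ℝ) (z : EuclideanSpace ℝ (Fin d)) : ℝ :=
  ∏ i, χ (z i)

/-- Directional derivative of a function along a vector. -/
def pderivAlong {X : Type*} [NormedAddCommGroup X] [NormedSpace ℝ X]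
    (v : X) (f : X → ℂ) : X → ℂ :=
  fun z => fderiv ℝ f z v

/-- Iterated directional (partial) derivatives along a list of directions. -/
def pderivList {X : Type*} [NormedAddCommGroup X] [NormedSpace ℝ X]
    (l : List X) (f : X → ℂ) : X → ℂ :=
  l.foldr pderivAlong f

/-- The multi-index derivative bounds `sup_{s,x,y} |∂_x^α ∂_y^β Φ(s,x,y)| ≤ D`
for all multi-indices `|α|, |β| ≤ 10d`. -/
def PhiDerivBound (d : ℕ) (D : ℝ)
    (Φ : ℝ → EuclideanSpace ℝ (Fin d) → EuclideanSpace ℝ (Fin d) → ℂ) : Prop :=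
  ∀ lx ly : List (Fin d), lx.length ≤ 10 * d → ly.length ≤ 10 * d →
    ∀ (s : ℝ) (x y : EuclideanSpace ℝ (Fin d)),
      ‖pderivList (lx.map fun i => EuclideanSpace.single i (1 : ℝ))
          (fun x' => pderivList (ly.map fun i => EuclideanSpace.single i (1 : ℝ))
            (fun y' => Φ s x' y') y) x‖ ≤ D

/-- The inner oscillatory integral appearing in the Poisson summation lemma. -/
def oscInt (d : ℕ) (χ : ℝ → ℝ)
    (Φ : ℝ → EuclideanSpace ℝ (Fin d) → EuclideanSpace ℝ (Fin d) → ℂ)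
    (lam L s : ℝ) (a b ξ ζ : EuclideanSpace ℝ (Fin d)) (g h : Fin d → ℤ) : ℂ :=
  ∫ p : EuclideanSpace ℝ (Fin d) × EuclideanSpace ℝ (Fin d),
    ((cutoffProd d χ (lam⁻¹ • (p.1 - a)) * cutoffProd d χ (lam⁻¹ • (p.2 - b)) : ℝ) : ℂ) *
      Φ s p.1 p.2 *
      efun ((∑ i, (L * ((g i : ℤ) : ℝ) + ξ i) * p.1 i) +
        (∑ i, (L * ((h i : ℤ) : ℝ) + ζ i) * p.2 i) + s * ⟪p.1, p.2⟫)


/-- The coordinate vectors of `ℝ^d` listed by `l`. -/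
def basisDirs {d : ℕ} (l : List (Fin d)) : List (EuclideanSpace ℝ (Fin d)) :=
  l.map fun i => EuclideanSpace.single i (1 : ℝ)

/-- All coordinate derivatives of `f` of order at most `n` are bounded by `B`. -/
def DerivBound {d : ℕ} (n : ℕ) (B : ℝ) (f : EuclideanSpace ℝ (Fin d) → ℂ) : Prop :=
  ∀ l : List (Fin d), l.length ≤ n → ∀ y, ‖pderivList (basisDirs l) f y‖ ≤ B

section Derivatives

variable {X : Type*} [NormedAddCommGroup X] [NormedSpace ℝ X]

lemma contDiff_pderivAlong {n : ℕ} {f : X → ℂ} (hf : ContDiff ℝ (n + 1 : ℕ) f) (v : X) :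
    ContDiff ℝ n (pderivAlong v f) := by
  unfold pderivAlong
  exact (hf.fderiv_right (m := (n : WithTop ℕ∞)) (by norm_cast)).clm_apply contDiff_const

lemma contDiff_pderivList (l : List X) {m : ℕ} {f : X → ℂ}
    (hf : ContDiff ℝ (l.length + m : ℕ) f) : ContDiff ℝ m (pderivList l f) := by
  induction l generalizing m with
  | nil => simpa [pderivList] using hf
  | cons v l ih =>
    refine contDiff_pderivAlong (ih ?_) v
    convert hf using 2
    simp only [List.length_cons]
    ring

lemma pderivList_add (l : List X) {f g : X → ℂ} (hf : ContDiff ℝ l.length f)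
    (hg : ContDiff ℝ l.length g) :
    pderivList l (fun y => f y + g y) = fun y => pderivList l f y + pderivList l g y := by
  induction l with
  | nil => rfl
  | cons v l ih =>
    have hle : (l.length : WithTop ℕ∞) ≤ ((v :: l).length : ℕ) := by
      simp only [List.length_cons]; norm_cast; omega
    have h1 : ContDiff ℝ (1 : ℕ) (pderivList l f) := contDiff_pderivList l (by simpa using hf)
    have h2 : ContDiff ℝ (1 : ℕ) (pderivList l g) := contDiff_pderivList l (by simpa using hg)
    funext y
    change pderivAlong v (pderivList l fun y => f y + g y) y = _
    rw [ih (hf.of_le hle) (hg.of_le hle), pderivAlong,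
      fderiv_fun_add (h1.differentiable (by simp) y) (h2.differentiable (by simp) y)]
    rfl

lemma pderivList_append_singleton (l : List X) (v : X) (f : X → ℂ) :
    pderivList (l ++ [v]) f = pderivList l (pderivAlong v f) := by
  simp [pderivList]

lemma pderivAlong_mul {f g : X → ℂ} (hf : ContDiff ℝ (1 : ℕ) f) (hg : ContDiff ℝ (1 : ℕ) g)
    (v : X) : pderivAlong v (fun y => f y * g y) =
      fun y => f y * pderivAlong v g y + pderivAlong v f y * g y := by
  funext y
  simp only [pderivAlong]
  rw [fderiv_fun_mul (hf.differentiable (by simp) y) (hg.differentiable (by simp) y)]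
  simp [mul_comm]

lemma support_pderivList_subset {S : Set X} (hS : IsClosed S) (l : List X) {f : X → ℂ}
    (hf : Function.support f ⊆ S) : Function.support (pderivList l f) ⊆ S := by
  induction l with
  | nil => exact hf
  | cons v l ih =>
    refine fun y hy => (closure_minimal ih hS) (support_fderiv_subset ℝ fun h => hy ?_)
    change fderiv ℝ (pderivList l f) y v = 0
    rw [h]
    rfl

end Derivatives

section DerivBound

variable {d : ℕ}

lemma DerivBound.pderivAlong {n : ℕ} {B : ℝ} {f : EuclideanSpace ℝ (Fin d) → ℂ}
    (h : DerivBound (n + 1) B f) (i : Fin d) :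
    DerivBound n B (pderivAlong (EuclideanSpace.single i (1 : ℝ)) f) := by
  intro l hl y
  have := h (l ++ [i]) (by simpa using hl) y
  rwa [basisDirs, List.map_append, List.map_singleton, pderivList_append_singleton] at this

lemma DerivBound.mono {n m : ℕ} {A B : ℝ} {f : EuclideanSpace ℝ (Fin d) → ℂ}
    (h : DerivBound n A f) (hmn : m ≤ n) (hAB : A ≤ B) : DerivBound m B f :=
  fun l hl y => (h l (hl.trans hmn) y).trans hAB

lemma DerivBound.nonneg {n : ℕ} {B : ℝ} {f : EuclideanSpace ℝ (Fin d) → ℂ}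
    (h : DerivBound n B f) : 0 ≤ B :=
  (norm_nonneg _).trans (h [] (by simp) 0)

lemma DerivBound.add {n : ℕ} {A B : ℝ} {f g : EuclideanSpace ℝ (Fin d) → ℂ}
    (hf : DerivBound n A f) (hg : DerivBound n B g) (hfc : ContDiff ℝ n f)
    (hgc : ContDiff ℝ n g) : DerivBound n (A + B) (fun y => f y + g y) := by
  intro l hl y
  have hle : ((basisDirs l).length : WithTop ℕ∞) ≤ n := by
    simpa [basisDirs] using hl
  rw [pderivList_add _ (hfc.of_le hle) (hgc.of_le hle)]
  exact (norm_add_le _ _).trans (add_le_add (hf l hl y) (hg l hl y))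

lemma derivBound_succ {n : ℕ} {B : ℝ} {f : EuclideanSpace ℝ (Fin d) → ℂ}
    (h0 : ∀ y, ‖f y‖ ≤ B)
    (h : ∀ i, DerivBound n B (_root_.pderivAlong (EuclideanSpace.single i (1 : ℝ)) f)) :
    DerivBound (n + 1) B f := by
  intro l
  induction l using List.reverseRecOn with
  | nil => exact fun _ => h0
  | append_singleton l i _ =>
    intro hl y
    rw [basisDirs, List.map_append, List.map_singleton, pderivList_append_singleton]
    exact h i l (by simpa using hl) y

lemma DerivBound.mul {n : ℕ} {A B : ℝ} {f g : EuclideanSpace ℝ (Fin d) → ℂ}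
    (hf : DerivBound n A f) (hg : DerivBound n B g) (hfc : ContDiff ℝ n f)
    (hgc : ContDiff ℝ n g) : DerivBound n (2 ^ n * (A * B)) (fun y => f y * g y) := by
  have h0 {m : ℕ} {A B : ℝ} {f g : EuclideanSpace ℝ (Fin d) → ℂ} (hf : DerivBound m A f)
      (hg : DerivBound m B g) (y) : ‖f y * g y‖ ≤ 2 ^ m * (A * B) := by
    have h1 : ‖f y‖ ≤ A := hf [] (by simp) y
    have h2 : ‖g y‖ ≤ B := hg [] (by simp) y
    rw [norm_mul]
    have h3 : ‖f y‖ * ‖g y‖ ≤ A * B := mul_le_mul h1 h2 (norm_nonneg _) hf.nonneg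
    exact h3.trans (le_mul_of_one_le_left (mul_nonneg hf.nonneg hg.nonneg)
      (one_le_pow₀ (by norm_num)))
  induction n generalizing f g with
  | zero =>
    intro l hl y
    obtain rfl : l = [] := by simpa using hl
    exact h0 hf hg y
  | succ n ih =>
    have hle : (n : WithTop ℕ∞) ≤ (n + 1 : ℕ) := by norm_cast; omega
    have h1le : ((1 : ℕ) : WithTop ℕ∞) ≤ (n + 1 : ℕ) := by norm_cast; omega
    refine derivBound_succ (h0 hf hg) fun i => ?_
    rw [pderivAlong_mul (hfc.of_le h1le) (hgc.of_le h1le)]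
    have hfc' := contDiff_pderivAlong hfc (EuclideanSpace.single i (1 : ℝ))
    have hgc' := contDiff_pderivAlong hgc (EuclideanSpace.single i (1 : ℝ))
    have := (ih (hf.mono n.le_succ le_rfl) (hg.pderivAlong i) (hfc.of_le hle) hgc').add
      (ih (hf.pderivAlong i) (hg.mono n.le_succ le_rfl) hfc' (hgc.of_le hle))
      ((hfc.of_le hle).mul hgc') (hfc'.mul (hgc.of_le hle))
    refine this.mono le_rfl (le_of_eq ?_)
    ring

lemma derivBound_const {n : ℕ} (c : ℂ) : DerivBound (d := d) n ‖c‖ (fun _ => c) := by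
  induction n generalizing c with
  | zero =>
    intro l hl y
    obtain rfl : l = [] := by simpa using hl
    exact le_rfl
  | succ n ih =>
    refine derivBound_succ (fun _ => le_rfl) fun i => ?_
    have : pderivAlong (EuclideanSpace.single i (1 : ℝ)) (fun _ : EuclideanSpace ℝ (Fin d) => c) =
        fun _ => (0 : ℂ) := by
      funext y
      simp [_root_.pderivAlong]
    rw [this]
    exact (ih 0).mono le_rfl (by simp)

lemma DerivBound.prod {n : ℕ} {B : ℝ} {ι : Type*} (s : Finset ι)
    {f : ι → EuclideanSpace ℝ (Fin d) → ℂ} (hf : ∀ i, DerivBound n B (f i))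
    (hfc : ∀ i, ContDiff ℝ n (f i)) :
    DerivBound n ((2 ^ n * B) ^ s.card) (fun y => ∏ i ∈ s, f i y) := by
  classical
  induction s using Finset.induction_on with
  | empty => simpa using derivBound_const (d := d) (n := n) 1
  | insert i s hi ih =>
    simp only [Finset.prod_insert hi, Finset.card_insert_of_notMem hi]
    refine ((hf i).mul ih (hfc i) (contDiff_prod fun i _ => hfc i)).mono le_rfl (le_of_eq ?_)
    ring

lemma derivBound_coord {φ : ℝ → ℂ} {n : ℕ} {B : ℝ} (hφ : ContDiff ℝ n φ)
    (hB : ∀ k ≤ n, ∀ t, ‖iteratedDeriv k φ t‖ ≤ B) {r : ℝ} (hr0 : 0 ≤ r) (hr : r ≤ 1)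
    (c : ℝ) (i : Fin d) :
    DerivBound n B (fun y : EuclideanSpace ℝ (Fin d) => φ (r * (y i - c))) := by
  induction n generalizing φ B with
  | zero =>
    intro l hl y
    obtain rfl : l = [] := by simpa using hl
    simpa [pderivList, basisDirs] using hB 0 le_rfl (r * (y i - c))
  | succ n ih =>
    refine derivBound_succ (fun y => by simpa using hB 0 (by simp) (r * (y i - c))) fun j => ?_
    have hφ' : ContDiff ℝ n (deriv φ) := by
      have : ContDiff ℝ ((n : WithTop ℕ∞) + 1) φ := by exact_mod_cast hφ
      exact (contDiff_succ_iff_deriv.1 this).2.2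
    set e : ℝ := (EuclideanSpace.single j (1 : ℝ) : EuclideanSpace ℝ (Fin d)) i with he
    have he1 : |e| ≤ 1 := by
      by_cases hij : i = j <;> simp [he, hij]
    have hpd : pderivAlong (EuclideanSpace.single j (1 : ℝ))
        (fun y : EuclideanSpace ℝ (Fin d) => φ (r * (y i - c))) =
        fun y => (fun t => ((r * e : ℝ) : ℂ) * deriv φ t) (r * (y i - c)) := by
      funext y
      have h1 : HasFDerivAt (fun y : EuclideanSpace ℝ (Fin d) => r * (y i - c))
          (r • (EuclideanSpace.proj i : EuclideanSpace ℝ (Fin d) →L[ℝ] ℝ)) y :=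
        (((EuclideanSpace.proj i : EuclideanSpace ℝ (Fin d) →L[ℝ] ℝ).hasFDerivAt).sub_const
          c).const_mul r
      have h2 : HasDerivAt φ (deriv φ (r * (y i - c))) (r * (y i - c)) :=
        (hφ.differentiable (by simp) _).hasDerivAt
      have h3 := h2.hasFDerivAt.comp y h1
      change fderiv ℝ (φ ∘ fun y : EuclideanSpace ℝ (Fin d) => r * (y i - c)) y _ = _
      rw [h3.fderiv, he]
      simp only [ContinuousLinearMap.coe_comp, Function.comp_apply, smul_apply,
        ContinuousLinearMap.toSpanSingleton_apply, smul_eq_mul, Complex.real_smul]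
      rfl
    rw [hpd]
    refine ih (contDiff_const.mul hφ') fun k hk t => ?_
    have h4 := hB (k + 1) (by omega) t
    rw [iteratedDeriv_succ'] at h4
    have h5 : iteratedDeriv k (fun t => ((r * e : ℝ) : ℂ) * deriv φ t) t =
        ((r * e : ℝ) : ℂ) * iteratedDeriv k (deriv φ) t :=
      iteratedDeriv_const_mul _ ((hφ'.of_le (by exact_mod_cast hk)).contDiffAt)
    rw [h5, norm_mul, Complex.norm_real, Real.norm_eq_abs, abs_mul, abs_of_nonneg hr0]
    calc r * |e| * ‖iteratedDeriv k (deriv φ) t‖ ≤ 1 * ‖iteratedDeriv k (deriv φ) t‖ := by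
          gcongr
          exact mul_le_one₀ hr (abs_nonneg _) he1
      _ ≤ B := by rwa [one_mul]

end DerivBound

section Fourier

variable {d : ℕ}

/-- The closed cube of centre `b` and half-side `r`. -/
def cube (b : EuclideanSpace ℝ (Fin d)) (r : ℝ) : Set (EuclideanSpace ℝ (Fin d)) :=
  {y | ∀ i, |y i - b i| ≤ r}

lemma isCompact_cube (b : EuclideanSpace ℝ (Fin d)) (r : ℝ) : IsCompact (cube b r) := by
  have h : IsCompact (Set.univ.pi fun i => Metric.closedBall (b i) r) :=
    isCompact_univ_pi fun i => isCompact_closedBall _ _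
  have := (EuclideanSpace.equiv (Fin d) ℝ).toHomeomorph.isCompact_preimage.2 h
  convert this using 1
  ext y
  simp [cube, Real.dist_eq]

lemma integral_prod_coord (f : Fin d → ℝ → ℝ) :
    ∫ x : EuclideanSpace ℝ (Fin d), ∏ i, f i (x i) = ∏ i, ∫ t, f i t := by
  rw [← integral_fintype_prod_volume_eq_prod]
  exact (PiLp.volume_preserving_ofLp (Fin d)).integral_comp
    (MeasurableEquiv.toLp 2 (Fin d → ℝ)).symm.measurableEmbedding (fun x => ∏ i, f i (x i))

lemma integrable_prod_coord {f : Fin d → ℝ → ℝ} (hf : ∀ i, Integrable (f i)) :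
    Integrable (fun x : EuclideanSpace ℝ (Fin d) => ∏ i, f i (x i)) :=
  (PiLp.volume_preserving_ofLp (Fin d)).integrable_comp_of_integrable
    (Integrable.fintype_prod hf)

lemma norm_efun (t : ℝ) : ‖efun t‖ = 1 := by
  have : 2 * (Real.pi : ℂ) * Complex.I * (t : ℂ) = ((2 * Real.pi * t : ℝ) : ℂ) * Complex.I := by
    push_cast; ring
  rw [efun, this, Complex.norm_exp_ofReal_mul_I]

lemma efun_add (s t : ℝ) : efun (s + t) = efun s * efun t := by
  rw [efun, efun, efun, ← Complex.exp_add]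
  push_cast
  ring_nf

lemma contDiff_efun {n : WithTop ℕ∞} : ContDiff ℝ n efun := by
  unfold efun
  exact (contDiff_const.mul Complex.ofRealCLM.contDiff).cexp

lemma hasDerivAt_efun (t : ℝ) : HasDerivAt efun (2 * Real.pi * Complex.I * efun t) t := by
  have h : HasDerivAt (fun t : ℝ => 2 * (Real.pi : ℂ) * Complex.I * (t : ℂ))
      (2 * Real.pi * Complex.I) t := by
    simpa using (Complex.ofRealCLM.hasDerivAt (x := t)).const_mul (2 * (Real.pi : ℂ) * Complex.I)
  have h' := h.cexp
  rw [mul_comm (Complex.exp _)] at h'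
  exact h'

/-- The linear form with coefficients `ω`. -/
def linForm (ω : Fin d → ℝ) : EuclideanSpace ℝ (Fin d) →L[ℝ] ℝ :=
  ∑ i, ω i • (EuclideanSpace.proj i : EuclideanSpace ℝ (Fin d) →L[ℝ] ℝ)

lemma linForm_apply (ω : Fin d → ℝ) (y : EuclideanSpace ℝ (Fin d)) :
    linForm ω y = ∑ i, ω i * y i := by
  simp [linForm]

lemma fderiv_efun_linForm (ω : Fin d → ℝ) (i : Fin d) (y : EuclideanSpace ℝ (Fin d)) :
    fderiv ℝ (fun y => efun (linForm ω y)) y (EuclideanSpace.single i (1 : ℝ)) =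
      2 * Real.pi * Complex.I * ω i * efun (linForm ω y) := by
  have h := (hasDerivAt_efun (linForm ω y)).hasFDerivAt.comp y (linForm ω).hasFDerivAt
  change fderiv ℝ (efun ∘ linForm ω) y _ = _
  rw [h.fderiv]
  have : linForm ω (EuclideanSpace.single i (1 : ℝ)) = ω i := by
    simp [linForm_apply]
  simp only [ContinuousLinearMap.coe_comp, Function.comp_apply, this,
    ContinuousLinearMap.toSpanSingleton_apply, Complex.real_smul]
  ring

lemma integral_pderivAlong_mul_efun {f : EuclideanSpace ℝ (Fin d) → ℂ}
    {S : Set (EuclideanSpace ℝ (Fin d))} (hS : IsCompact S) (hfS : Function.support f ⊆ S)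
    (hf : ContDiff ℝ (1 : ℕ) f) (ω : Fin d → ℝ) (i : Fin d) :
    ∫ y, pderivAlong (EuclideanSpace.single i (1 : ℝ)) f y * efun (linForm ω y) =
      -(2 * Real.pi * Complex.I * ω i) * ∫ y, f y * efun (linForm ω y) := by
  have hfc : HasCompactSupport f :=
    HasCompactSupport.intro hS fun x hx => by
      by_contra h
      exact hx (hfS h)
  have hec : Continuous fun y => efun (linForm ω y) :=
    (contDiff_efun (n := 0)).continuous.comp (linForm ω).continuous
  have hed : Differentiable ℝ fun y => efun (linForm ω y) :=
    ((contDiff_efun (n := 1)).differentiable (by simp)).comp (linForm ω).differentiable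
  have hfd : Continuous fun y => fderiv ℝ f y (EuclideanSpace.single i (1 : ℝ)) :=
    (hf.continuous_fderiv (by simp)).clm_apply continuous_const
  have h1 : Integrable (fun y => f y * efun (linForm ω y)) :=
    (hf.continuous.mul hec).integrable_of_hasCompactSupport hfc.mul_right
  have h2 : Integrable
      (fun y => fderiv ℝ f y (EuclideanSpace.single i (1 : ℝ)) * efun (linForm ω y)) :=
    (hfd.mul hec).integrable_of_hasCompactSupport
      (HasCompactSupport.mul_right (hfc.fderiv_apply ℝ _))
  have key := integral_mul_fderiv_eq_neg_fderiv_mul_of_integrable (𝕜 := ℂ) h2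
    (by
      simp only [fderiv_efun_linForm]
      convert h1.const_mul (2 * Real.pi * Complex.I * ω i) using 2
      ring)
    h1 (fun x _ => hf.differentiable (by simp) x) (fun x _ => hed x)
  simp only [fderiv_efun_linForm] at key
  have h3 : ∫ y, f y * (2 * Real.pi * Complex.I * ω i * efun (linForm ω y)) =
      2 * Real.pi * Complex.I * ω i * ∫ y, f y * efun (linForm ω y) := by
    rw [← integral_const_mul]
    congr 1
    funext y
    ring
  rw [h3] at key
  rw [neg_mul, key, neg_neg]
  rfl

lemma integral_pderivList_mul_efun {f : EuclideanSpace ℝ (Fin d) → ℂ}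
    {S : Set (EuclideanSpace ℝ (Fin d))} (hS : IsCompact S) (hfS : Function.support f ⊆ S)
    (l : List (Fin d)) (hf : ContDiff ℝ l.length f) (ω : Fin d → ℝ) :
    ∫ y, pderivList (basisDirs l) f y * efun (linForm ω y) =
      (l.map fun i => -(2 * Real.pi * Complex.I * ω i)).prod *
        ∫ y, f y * efun (linForm ω y) := by
  induction l with
  | nil => simp [pderivList, basisDirs]
  | cons i l ih =>
    have h1 : ContDiff ℝ (1 : ℕ) (pderivList (basisDirs l) f) :=
      contDiff_pderivList _ (by simpa [basisDirs] using hf)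
    have h2 := integral_pderivAlong_mul_efun hS
      (support_pderivList_subset hS.isClosed (basisDirs l) hfS) h1 ω i
    rw [ih (hf.of_le (by simp only [List.length_cons]; norm_cast; omega))] at h2
    rw [List.map_cons, List.prod_cons, mul_assoc, ← h2]
    rfl

lemma exists_list_map_prod_eq (A : Finset (Fin d)) (n : ℕ) :
    ∃ l : List (Fin d), l.length = n * A.card ∧
      ∀ f : Fin d → ℂ, (l.map f).prod = ∏ i ∈ A, f i ^ n := by
  classical
  induction A using Finset.induction_on with
  | empty => exact ⟨[], by simp⟩
  | insert i s hi ih =>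
    obtain ⟨l, hl, hl'⟩ := ih
    refine ⟨List.replicate n i ++ l, ?_, fun f => ?_⟩
    · rw [List.length_append, List.length_replicate, hl, Finset.card_insert_of_notMem hi]
      ring
    · rw [List.map_append, List.prod_append, hl', Finset.prod_insert hi]
      simp

lemma norm_integral_le_of_support_cube {f : EuclideanSpace ℝ (Fin d) → ℂ}
    {B r : ℝ} (hB : 0 ≤ B) {b : EuclideanSpace ℝ (Fin d)}
    {w : Fin d → ℝ → ℝ} (hw : ∀ i, Continuous (w i)) (hw0 : ∀ i t, 0 ≤ w i t)
    (hfS : Function.support f ⊆ cube b r) (hf : ∀ y, ‖f y‖ ≤ B * ∏ i, w i (y i)) :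
    ‖∫ y, f y‖ ≤ B * ∏ i, ∫ t in Set.Icc (b i - r) (b i + r), w i t := by
  have hint : ∀ i, Integrable ((Set.Icc (b i - r) (b i + r)).indicator (w i)) := fun i =>
    ((hw i).continuousOn.integrableOn_Icc).integrable_indicator measurableSet_Icc
  have h1 : ∀ y : EuclideanSpace ℝ (Fin d), ‖f y‖ ≤
      B * ∏ i, (Set.Icc (b i - r) (b i + r)).indicator (w i) (y i) := by
    intro y
    by_cases hy : f y = 0
    · rw [hy, norm_zero]
      exact mul_nonneg hB (Finset.prod_nonneg fun i _ =>
        Set.indicator_nonneg (fun t _ => hw0 i t) _)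
    · have hy' := hfS hy
      refine (hf y).trans (le_of_eq ?_)
      congr 1
      refine Finset.prod_congr rfl fun i _ => ?_
      rw [Set.indicator_of_mem]
      have := abs_le.1 (hy' i)
      constructor <;> linarith
  refine (norm_integral_le_integral_norm f).trans ?_
  refine (integral_mono_of_nonneg (Filter.Eventually.of_forall fun y => norm_nonneg _)
    ((integrable_prod_coord hint).const_mul B) (Filter.Eventually.of_forall h1)).trans ?_
  rw [integral_const_mul, integral_prod_coord]
  simp only [integral_indicator measurableSet_Icc]
  exact le_rfl

lemma norm_fourier_le {f : EuclideanSpace ℝ (Fin d) → ℂ} {B r : ℝ} (hr : 0 ≤ r)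
    {b : EuclideanSpace ℝ (Fin d)} (hfS : Function.support f ⊆ cube b r)
    (hf : ContDiff ℝ (5 * d : ℕ) f) (hB : DerivBound (5 * d) B f) (ω : Fin d → ℝ) :
    ‖∫ y, f y * efun (linForm ω y)‖ ≤ B * (64 * r) ^ d * ∏ i, ((1 + |ω i|) ^ 5)⁻¹ := by
  classical
  set A : Finset (Fin d) := Finset.univ.filter fun i => 1 ≤ |ω i| with hA
  obtain ⟨l, hl, hlp⟩ := exists_list_map_prod_eq A 5
  have hld : l.length ≤ 5 * d := by
    rw [hl]
    have := A.card_le_univ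
    simp only [Fintype.card_fin] at this
    omega
  have hbase := integral_pderivList_mul_efun (isCompact_cube b r) hfS l
    (hf.of_le (by exact_mod_cast hld)) ω
  have hup : ‖∫ y, pderivList (basisDirs l) f y * efun (linForm ω y)‖ ≤ B * (2 * r) ^ d := by
    have := norm_integral_le_of_support_cube (b := b) (r := r) (w := fun _ _ => 1)
      (f := fun y => pderivList (basisDirs l) f y * efun (linForm ω y)) hB.nonneg
      (fun i => continuous_const) (fun i t => zero_le_one)
      (fun y hy => support_pderivList_subset (isCompact_cube b r).isClosed (basisDirs l) hfS
        (left_ne_zero_of_mul hy))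
      (fun y => by simpa [norm_efun] using hB l hld y)
    refine this.trans (le_of_eq ?_)
    congr 1
    simp only [integral_const, MeasurableSet.univ, measureReal_restrict_apply, Set.univ_inter,
      Real.volume_real_Icc, smul_eq_mul, mul_one]
    have : ∀ i, max (b i + r - (b i - r)) 0 = 2 * r := fun i => by
      rw [max_eq_left] <;> linarith
    simp only [this, Finset.prod_const, Finset.card_univ, Fintype.card_fin]
  rw [hbase, norm_mul, hlp, norm_prod] at hup
  have hlow : ∏ i, (1 + |ω i|) ^ 5 ≤
      32 ^ d * ∏ i ∈ A, ‖(-(2 * (Real.pi : ℂ) * Complex.I * ω i)) ^ 5‖ := by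
    have h1 : ∏ i ∈ A, ‖(-(2 * (Real.pi : ℂ) * Complex.I * ω i)) ^ 5‖ =
        ∏ i, if 1 ≤ |ω i| then ‖(-(2 * (Real.pi : ℂ) * Complex.I * ω i)) ^ 5‖ else 1 := by
      rw [hA, Finset.prod_filter]
    have h2 : (32 : ℝ) ^ d = ∏ _i : Fin d, (32 : ℝ) := by simp
    rw [h1, h2, ← Finset.prod_mul_distrib]
    refine Finset.prod_le_prod (fun i _ => by positivity) fun i _ => ?_
    split_ifs with h
    · have h3 : ‖(-(2 * (Real.pi : ℂ) * Complex.I * ω i)) ^ 5‖ = (2 * Real.pi * |ω i|) ^ 5 := by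
        simp [abs_of_pos Real.pi_pos]
      rw [h3]
      have h4 : 1 + |ω i| ≤ 2 * Real.pi * |ω i| := by
        nlinarith [Real.pi_gt_three]
      have h5 : (1 + |ω i|) ^ 5 ≤ (2 * Real.pi * |ω i|) ^ 5 := by gcongr
      have : 0 ≤ (2 * Real.pi * |ω i|) ^ 5 := by positivity
      linarith
    · have h4 : 1 + |ω i| ≤ 2 := by linarith [not_le.1 h]
      calc (1 + |ω i|) ^ 5 ≤ 2 ^ 5 := by gcongr
        _ = 32 * 1 := by norm_num
  rw [Finset.prod_inv_distrib, ← div_eq_mul_inv, le_div_iff₀ (by positivity)]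
  calc ‖∫ y, f y * efun (linForm ω y)‖ * ∏ i, (1 + |ω i|) ^ 5
      ≤ ‖∫ y, f y * efun (linForm ω y)‖ *
        (32 ^ d * ∏ i ∈ A, ‖(-(2 * (Real.pi : ℂ) * Complex.I * ω i)) ^ 5‖) := by gcongr
    _ = 32 ^ d * ((∏ i ∈ A, ‖(-(2 * (Real.pi : ℂ) * Complex.I * ω i)) ^ 5‖) *
        ‖∫ y, f y * efun (linForm ω y)‖) := by ring
    _ ≤ 32 ^ d * (B * (2 * r) ^ d) := by gcongr
    _ = B * (64 * r) ^ d := by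
      rw [show (64 : ℝ) * r = 32 * (2 * r) by ring, mul_pow 32]
      ring

end Fourier

section OscillatoryIntegral

variable {d : ℕ}

/-- All derivatives of `χ`, viewed as a complex function, of order at most `n` are bounded
by `M`. -/
def CutoffBound (χ : ℝ → ℝ) (n : ℕ) (M : ℝ) : Prop :=
  ∀ k ≤ n, ∀ t, ‖iteratedDeriv k (fun t => (χ t : ℂ)) t‖ ≤ M

lemma contDiff_ofReal_comp {χ : ℝ → ℝ} {n : WithTop ℕ∞} (hχ : ContDiff ℝ n χ) :
    ContDiff ℝ n fun t => (χ t : ℂ) :=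
  Complex.ofRealCLM.contDiff.comp hχ

lemma exists_cutoffBound {χ : ℝ → ℝ} (hχ : ContDiff ℝ (⊤ : ℕ∞) χ)
    (hχ0 : ∀ z : ℝ, 1 ≤ |z| → χ z = 0) (n : ℕ) : ∃ M, CutoffBound χ n M := by
  have hc : HasCompactSupport fun t => (χ t : ℂ) :=
    HasCompactSupport.intro (isCompact_Icc (a := (-1 : ℝ)) (b := 1)) fun x hx => by
      rw [hχ0 x, Complex.ofReal_zero]
      by_contra h
      exact hx (abs_le.1 (not_le.1 h).le)
  have h : ∀ k : ℕ, ∃ M, ∀ t, ‖iteratedDeriv k (fun t => (χ t : ℂ)) t‖ ≤ M := by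
    intro k
    have h1 : Continuous (iteratedFDeriv ℝ k fun t => (χ t : ℂ)) :=
      (contDiff_ofReal_comp hχ).continuous_iteratedFDeriv (by exact_mod_cast le_top)
    obtain ⟨M, hM⟩ := h1.bounded_above_of_compact_support (hc.iteratedFDeriv k)
    exact ⟨M, fun t => by simpa [norm_iteratedFDeriv_eq_norm_iteratedDeriv] using hM t⟩
  choose M hM using h
  refine ⟨∑ k ∈ Finset.range (n + 1), M k, fun k hk t => (hM k t).trans ?_⟩
  exact Finset.single_le_sum (f := M) (fun i _ => (norm_nonneg _).trans (hM i 0))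
    (Finset.mem_range.2 (by omega))

lemma cutoffProd_eq_prod (χ : ℝ → ℝ) (r : ℝ) (b y : EuclideanSpace ℝ (Fin d)) :
    ((cutoffProd d χ (r • (y - b)) : ℝ) : ℂ) = ∏ i, (fun t => (χ t : ℂ)) (r * (y i - b i)) := by
  simp [cutoffProd]

lemma contDiff_cutoffProd {χ : ℝ → ℝ} {n : WithTop ℕ∞} (hχ : ContDiff ℝ n χ) (r : ℝ)
    (b : EuclideanSpace ℝ (Fin d)) :
    ContDiff ℝ n fun y : EuclideanSpace ℝ (Fin d) => ((cutoffProd d χ (r • (y - b)) : ℝ) : ℂ) := by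
  simp only [cutoffProd_eq_prod]
  refine contDiff_prod fun i _ => (contDiff_ofReal_comp hχ).comp ?_
  exact contDiff_const.mul ((EuclideanSpace.proj i : EuclideanSpace ℝ (Fin d) →L[ℝ] ℝ).contDiff.sub
    contDiff_const)

lemma support_cutoffProd_subset {χ : ℝ → ℝ} (hχ0 : ∀ z : ℝ, 1 ≤ |z| → χ z = 0) {r : ℝ}
    (hr : 0 < r) (b : EuclideanSpace ℝ (Fin d)) :
    Function.support (fun y => ((cutoffProd d χ (r⁻¹ • (y - b)) : ℝ) : ℂ)) ⊆ cube b r := by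
  intro y hy i
  by_contra h
  refine hy ?_
  simp only [cutoffProd_eq_prod]
  refine Finset.prod_eq_zero (Finset.mem_univ i) ?_
  have : χ (r⁻¹ * (y i - b i)) = 0 := by
    refine hχ0 _ ?_
    rw [abs_mul, abs_of_pos (inv_pos.2 hr), inv_mul_eq_div, le_div_iff₀ hr, one_mul]
    exact (not_le.1 h).le
  simp [this]

lemma derivBound_cutoffProd {χ : ℝ → ℝ} {n : ℕ} {M : ℝ} (hχ : ContDiff ℝ n χ)
    (hM : CutoffBound χ n M) {r : ℝ} (hr0 : 0 ≤ r) (hr1 : r ≤ 1)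
    (b : EuclideanSpace ℝ (Fin d)) :
    DerivBound n ((2 ^ n * M) ^ d)
      (fun y : EuclideanSpace ℝ (Fin d) => ((cutoffProd d χ (r • (y - b)) : ℝ) : ℂ)) := by
  simp only [cutoffProd_eq_prod]
  have hχc := contDiff_ofReal_comp hχ
  have := DerivBound.prod (d := d) Finset.univ
    (f := fun i y => (fun t => (χ t : ℂ)) (r * (y i - b i)))
    (fun i => derivBound_coord hχc hM hr0 hr1 (b i) i)
    (fun i => hχc.comp (contDiff_const.mul
      ((EuclideanSpace.proj i : EuclideanSpace ℝ (Fin d) →L[ℝ] ℝ).contDiff.sub contDiff_const)))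
  simpa using this

/-- The integral of `oscInt` with arbitrary linear frequencies `k` and `l`. -/
def bilinOsc (χ : ℝ → ℝ) (lam : ℝ) (a b : EuclideanSpace ℝ (Fin d)) (k l : Fin d → ℝ) (s : ℝ)
    (Φ : EuclideanSpace ℝ (Fin d) → EuclideanSpace ℝ (Fin d) → ℂ) : ℂ :=
  ∫ p : EuclideanSpace ℝ (Fin d) × EuclideanSpace ℝ (Fin d),
    ((cutoffProd d χ (lam⁻¹ • (p.1 - a)) * cutoffProd d χ (lam⁻¹ • (p.2 - b)) : ℝ) : ℂ) *
      Φ p.1 p.2 * efun (linForm k p.1 + linForm l p.2 + s * ⟪p.1, p.2⟫)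

lemma bilinOsc_swap (χ : ℝ → ℝ) (lam : ℝ) (a b : EuclideanSpace ℝ (Fin d)) (k l : Fin d → ℝ)
    (s : ℝ) (Φ : EuclideanSpace ℝ (Fin d) → EuclideanSpace ℝ (Fin d) → ℂ) :
    bilinOsc χ lam b a l k s (fun y x => Φ x y) = bilinOsc χ lam a b k l s Φ := by
  rw [bilinOsc, bilinOsc, Measure.volume_eq_prod, ← integral_prod_swap]
  congr 1
  funext p
  simp only [Prod.fst_swap, Prod.snd_swap]
  rw [real_inner_comm, mul_comm (cutoffProd d χ (lam⁻¹ • (p.2 - b))),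
    add_comm (linForm l p.2)]

lemma norm_bilinOsc_le {χ : ℝ → ℝ} {M D lam : ℝ} (hχ : ContDiff ℝ (⊤ : ℕ∞) χ)
    (hχ0 : ∀ z : ℝ, 1 ≤ |z| → χ z = 0) (hM : CutoffBound χ (5 * d) M) (hlam : 1 ≤ lam)
    {Φ : EuclideanSpace ℝ (Fin d) → EuclideanSpace ℝ (Fin d) → ℂ}
    (hΦ : ContDiff ℝ (5 * d : ℕ)
      fun p : EuclideanSpace ℝ (Fin d) × EuclideanSpace ℝ (Fin d) => Φ p.1 p.2)
    (hD : ∀ x, DerivBound (5 * d) D (Φ x)) (a b : EuclideanSpace ℝ (Fin d)) (k l : Fin d → ℝ)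
    (s : ℝ) :
    ‖bilinOsc χ lam a b k l s Φ‖ ≤
      M ^ d * (2 ^ (5 * d) * ((2 ^ (5 * d) * M) ^ d * D) * (64 * lam) ^ d) *
        ∏ i, ∫ t in Set.Icc (a i - lam) (a i + lam), ((1 + |l i + s * t|) ^ 5)⁻¹ := by
  have hlam0 : 0 < lam := one_pos.trans_le hlam
  have hM0 : 0 ≤ M := (norm_nonneg _).trans (hM 0 (by simp) 0)
  have hχn : ContDiff ℝ (5 * d : ℕ) χ := contDiff_infty.1 hχ (5 * d)
  set ca := fun x : EuclideanSpace ℝ (Fin d) => ((cutoffProd d χ (lam⁻¹ • (x - a)) : ℝ) : ℂ)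
    with hca
  set cb := fun x : EuclideanSpace ℝ (Fin d) => ((cutoffProd d χ (lam⁻¹ • (x - b)) : ℝ) : ℂ)
    with hcb
  have hcac : Continuous ca := (contDiff_cutoffProd hχn _ _).continuous
  have hcbc : ContDiff ℝ (5 * d : ℕ) cb := contDiff_cutoffProd hχn _ _
  have hca_supp : Function.support ca ⊆ cube a lam := support_cutoffProd_subset hχ0 hlam0 a
  have hcb_supp : Function.support cb ⊆ cube b lam := support_cutoffProd_subset hχ0 hlam0 b
  have hca_le : ∀ x, ‖ca x‖ ≤ M ^ d := by
    intro x
    simp only [hca, cutoffProd_eq_prod, norm_prod]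
    calc ∏ i, ‖(χ (lam⁻¹ * (x i - a i)) : ℂ)‖ ≤ ∏ _i : Fin d, M :=
          Finset.prod_le_prod (fun _ _ => norm_nonneg _) fun i _ => by
            simpa using hM 0 (by simp) (lam⁻¹ * (x i - a i))
      _ = M ^ d := by simp
  have hslice : ∀ x, ContDiff ℝ (5 * d : ℕ) (Φ x) := fun x =>
    hΦ.comp (contDiff_const.prodMk contDiff_id)
  have hint : Integrable (fun p : EuclideanSpace ℝ (Fin d) × EuclideanSpace ℝ (Fin d) =>
      ((cutoffProd d χ (lam⁻¹ • (p.1 - a)) * cutoffProd d χ (lam⁻¹ • (p.2 - b)) : ℝ) : ℂ) *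
      Φ p.1 p.2 * efun (linForm k p.1 + linForm l p.2 + s * ⟪p.1, p.2⟫))
      (Measure.prod volume volume) := by
    rw [← Measure.volume_eq_prod]
    have hec : Continuous fun p : EuclideanSpace ℝ (Fin d) × EuclideanSpace ℝ (Fin d) =>
        efun (linForm k p.1 + linForm l p.2 + s * ⟪p.1, p.2⟫) :=
      (contDiff_efun (n := 0)).continuous.comp (by fun_prop)
    simp only [Complex.ofReal_mul]
    refine ((((hcac.comp continuous_fst).mul (hcbc.continuous.comp continuous_snd)).mul
      hΦ.continuous).mul hec).integrable_of_hasCompactSupport ?_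
    refine HasCompactSupport.intro ((isCompact_cube a lam).prod (isCompact_cube b lam))
      fun p hp => ?_
    by_contra h
    have h' := left_ne_zero_of_mul (left_ne_zero_of_mul h)
    exact hp ⟨hca_supp (left_ne_zero_of_mul h'), hcb_supp (right_ne_zero_of_mul h')⟩
  have hinner : ∀ x : EuclideanSpace ℝ (Fin d), ∫ y : EuclideanSpace ℝ (Fin d),
      ((cutoffProd d χ (lam⁻¹ • (x - a)) * cutoffProd d χ (lam⁻¹ • (y - b)) : ℝ) : ℂ) *
      Φ x y * efun (linForm k x + linForm l y + s * ⟪x, y⟫) =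
      ca x * efun (linForm k x) *
        ∫ y, (cb y * Φ x y) * efun (linForm (fun i => l i + s * x i) y) := by
    intro x
    rw [← integral_const_mul]
    congr 1
    funext y
    have : linForm k x + linForm l y + s * ⟪x, y⟫ =
        linForm k x + linForm (fun i => l i + s * x i) y := by
      simp only [linForm_apply, PiLp.inner_apply, add_assoc, Finset.mul_sum, add_mul,
        Finset.sum_add_distrib, RCLike.inner_apply, conj_trivial]
      congr 2
      exact Finset.sum_congr rfl fun i _ => by ring
    rw [this, efun_add]
    simp only [hca, hcb, Complex.ofReal_mul]
    ring
  rw [bilinOsc, Measure.volume_eq_prod, integral_prod _ hint]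
  simp only [hinner]
  have hB : ∀ x, DerivBound (5 * d) (2 ^ (5 * d) * ((2 ^ (5 * d) * M) ^ d * D))
      (fun y => cb y * Φ x y) := fun x =>
    (derivBound_cutoffProd hχn hM (inv_nonneg.2 hlam0.le) (inv_le_one_of_one_le₀ hlam) b).mul
      (hD x) hcbc (hslice x)
  have hB0 := (hB 0).nonneg
  refine norm_integral_le_of_support_cube (by positivity)
    (w := fun i t => ((1 + |l i + s * t|) ^ 5)⁻¹) (fun i => ?_) (fun i t => by positivity)
    (fun x hx => hca_supp (left_ne_zero_of_mul (left_ne_zero_of_mul hx))) fun x => ?_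
  · exact Continuous.inv₀ (by fun_prop) fun t => by positivity
  · rw [norm_mul, norm_mul, norm_efun, mul_one, mul_assoc]
    refine mul_le_mul (hca_le x) ?_ (norm_nonneg _) (by positivity)
    exact norm_fourier_le hlam0.le
      (fun y hy => hcb_supp (left_ne_zero_of_mul hy)) (hcbc.mul (hslice x)) (hB x) _

end OscillatoryIntegral

section Estimates

/-- The integrable weight `(1 + |t|)^{-3/2}`. -/
def jap (t : ℝ) : ℝ := (1 + |t|) ^ (-(3 / 2) : ℝ)

lemma jap_nonneg (t : ℝ) : 0 ≤ jap t := by unfold jap; positivity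

lemma jap_le_one (t : ℝ) : jap t ≤ 1 :=
  Real.rpow_le_one_of_one_le_of_nonpos (by linarith [abs_nonneg t]) (by norm_num)

lemma jap_le_jap {s t : ℝ} (h : |s| ≤ |t|) : jap t ≤ jap s :=
  Real.rpow_le_rpow_of_nonpos (by linarith [abs_nonneg s]) (by linarith) (by norm_num)

lemma continuous_jap : Continuous jap := by
  unfold jap
  exact (continuous_const.add continuous_abs).rpow_const fun t =>
    Or.inl (by linarith [abs_nonneg t] : 0 < 1 + |t|).ne'

lemma integrable_jap : Integrable jap :=
  integrable_one_add_norm (E := ℝ) (by simp; norm_num)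

/-- The total mass of the weight `jap`. -/
def japMass : ℝ := ∫ t, jap t

lemma japMass_nonneg : 0 ≤ japMass := integral_nonneg jap_nonneg

lemma integrable_jap_affine {a : ℝ} (ha : a ≠ 0) (c : ℝ) :
    Integrable fun s => jap (c + a * s) :=
  (integrable_jap.comp_add_left c).comp_mul_left' ha

lemma integral_jap_affine (a c : ℝ) : ∫ s, jap (c + a * s) = japMass / |a| := by
  rw [Measure.integral_comp_mul_left (fun t => jap (c + t)) a,
    integral_add_left_eq_self (μ := volume) jap c, smul_eq_mul, abs_inv, japMass]
  ring

lemma lintegral_jap_affine {a : ℝ} (ha : a ≠ 0) (c : ℝ) :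
    ∫⁻ s, ENNReal.ofReal (jap (c + a * s)) = ENNReal.ofReal (japMass / |a|) := by
  rw [← integral_jap_affine a c, ofReal_integral_eq_lintegral_ofReal (integrable_jap_affine ha c)
    (Filter.Eventually.of_forall fun s => jap_nonneg _)]

lemma setIntegral_jap_affine_le {lam : ℝ} (hlam : 1 ≤ lam) (a l s : ℝ) :
    ∫ t in Set.Icc (a - lam) (a + lam), jap (l + s * t) ≤
      (4 + 2 * japMass) * (lam / (1 + |s|)) := by
  have hK := japMass_nonneg
  have hc : Continuous fun t => jap (l + s * t) := continuous_jap.comp (by fun_prop)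
  have hs0 := abs_nonneg s
  rcases le_total |s| 1 with hs | hs
  · have h1 : ∫ t in Set.Icc (a - lam) (a + lam), jap (l + s * t) ≤
        ∫ t in Set.Icc (a - lam) (a + lam), (1 : ℝ) :=
      setIntegral_mono_on hc.continuousOn.integrableOn_Icc
        continuousOn_const.integrableOn_Icc measurableSet_Icc
        fun t _ => jap_le_one _
    have h2 : ∫ t in Set.Icc (a - lam) (a + lam), (1 : ℝ) = 2 * lam := by
      simp only [integral_const, MeasurableSet.univ, measureReal_restrict_apply, Set.univ_inter,
        Real.volume_real_Icc, smul_eq_mul, mul_one]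
      rw [max_eq_left] <;> linarith
    rw [h2] at h1
    refine h1.trans ?_
    rw [← mul_div_assoc, le_div_iff₀ (by positivity)]
    nlinarith [mul_nonneg hK (by linarith : 0 ≤ lam)]
  · have hs' : s ≠ 0 := by
      rintro rfl
      simp at hs
      linarith
    have h1 : ∫ t in Set.Icc (a - lam) (a + lam), jap (l + s * t) ≤ japMass / |s| := by
      rw [← integral_jap_affine s l]
      exact setIntegral_le_integral (integrable_jap_affine hs' l)
        (Filter.Eventually.of_forall fun t => jap_nonneg _)
    refine h1.trans ?_
    rw [← mul_div_assoc, div_le_div_iff₀ (by linarith) (by positivity)]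
    have h3 : japMass * (1 + |s|) ≤ 2 * japMass * |s| := by nlinarith
    have h4 : 2 * japMass * |s| ≤ (4 + 2 * japMass) * |s| := by nlinarith
    have h5 : (4 + 2 * japMass) * |s| * 1 ≤ (4 + 2 * japMass) * |s| * lam := by gcongr
    nlinarith

/-- The decay weight of an oscillatory integral whose phase varies at rate `t` near its centre,
against a fluctuation of size `M`. -/
def decayWt (M t : ℝ) : ℝ := (min 1 (M / (1 + |t|))) ^ (3 / 2 : ℝ)

lemma decayWt_nonneg {M : ℝ} (hM : 0 ≤ M) (t : ℝ) : 0 ≤ decayWt M t :=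
  Real.rpow_nonneg (le_min zero_le_one (by positivity)) _

lemma decayWt_sq {M : ℝ} (hM : 0 ≤ M) (t : ℝ) :
    decayWt M t ^ 2 = (min 1 (M / (1 + |t|))) ^ 3 := by
  have h : 0 ≤ min 1 (M / (1 + |t|)) := le_min zero_le_one (by positivity)
  rw [decayWt, ← Real.rpow_natCast, ← Real.rpow_mul h, ← Real.rpow_natCast]
  norm_num

lemma decayWt_le_mul_jap {M : ℝ} (hM : 0 ≤ M) (t : ℝ) :
    decayWt M t ≤ M ^ (3 / 2 : ℝ) * jap t := by
  have h : 0 ≤ min 1 (M / (1 + |t|)) := le_min zero_le_one (by positivity)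
  refine (Real.rpow_le_rpow h (min_le_right _ _) (by norm_num)).trans (le_of_eq ?_)
  rw [Real.div_rpow hM (by positivity), jap, Real.rpow_neg (by positivity), div_eq_mul_inv]

lemma setIntegral_inv_pow_le {lam : ℝ} (hlam : 1 ≤ lam) (a l s : ℝ) :
    ∫ t in Set.Icc (a - lam) (a + lam), ((1 + |l + s * t|) ^ 5)⁻¹ ≤
      (4 + 2 * japMass) * (lam / (1 + |s|)) * decayWt (lam * (1 + |s|)) (l + s * a) ^ 2 := by
  have hM : 0 ≤ lam * (1 + |s|) := by positivity
  rw [decayWt_sq hM]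
  set m := min 1 (lam * (1 + |s|) / (1 + |l + s * a|)) with hm
  have hm0 : 0 ≤ m := le_min zero_le_one (by positivity)
  have hpt : ∀ t ∈ Set.Icc (a - lam) (a + lam),
      ((1 + |l + s * t|) ^ 5)⁻¹ ≤ m ^ 3 * jap (l + s * t) := by
    intro t ht
    set u := 1 + |l + s * t| with hu
    have hu1 : 1 ≤ u := by linarith [abs_nonneg (l + s * t)]
    have hinv : u⁻¹ ≤ m := by
      refine le_min (inv_le_one_of_one_le₀ hu1) ?_
      rw [inv_eq_one_div, div_le_div_iff₀ (by linarith) (by positivity), one_mul]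
      have h1 : |l + s * a| ≤ |l + s * t| + |s| * lam := by
        have h2 : l + s * a = (l + s * t) + s * (a - t) := by ring
        have h3 : |a - t| ≤ lam := abs_le.2 ⟨by linarith [ht.2], by linarith [ht.1]⟩
        calc |l + s * a| ≤ |l + s * t| + |s * (a - t)| := by rw [h2]; exact abs_add_le _ _
          _ ≤ |l + s * t| + |s| * lam := by rw [abs_mul]; gcongr
      have hs0 := abs_nonneg s
      have h4 : 1 + |l + s * a| ≤ u + |s| * lam := by linarith
      have h5 : |s| * lam ≤ |s| * lam * u := le_mul_of_one_le_right (by positivity) hu1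
      have h6 : u ≤ lam * u := le_mul_of_one_le_left (by linarith) hlam
      linarith
    have hj : (u ^ 2)⁻¹ ≤ jap (l + s * t) := by
      rw [jap, ← hu, ← Real.rpow_natCast, ← Real.rpow_neg (by linarith)]
      exact Real.rpow_le_rpow_of_exponent_le hu1 (by norm_num)
    calc (u ^ 5)⁻¹ = u⁻¹ ^ 3 * (u ^ 2)⁻¹ := by field_simp
      _ ≤ m ^ 3 * jap (l + s * t) := by gcongr
  have hc : Continuous fun t => jap (l + s * t) := continuous_jap.comp (by fun_prop)
  have hc5 : Continuous fun t => ((1 + |l + s * t|) ^ 5)⁻¹ :=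
    Continuous.inv₀ (by fun_prop) fun t => by positivity
  calc ∫ t in Set.Icc (a - lam) (a + lam), ((1 + |l + s * t|) ^ 5)⁻¹
      ≤ ∫ t in Set.Icc (a - lam) (a + lam), m ^ 3 * jap (l + s * t) :=
        setIntegral_mono_on hc5.continuousOn.integrableOn_Icc
          (continuous_const.mul hc).continuousOn.integrableOn_Icc measurableSet_Icc hpt
    _ = m ^ 3 * ∫ t in Set.Icc (a - lam) (a + lam), jap (l + s * t) := integral_const_mul _ _
    _ ≤ m ^ 3 * ((4 + 2 * japMass) * (lam / (1 + |s|))) := by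
        gcongr
        exact setIntegral_jap_affine_le hlam a l s
    _ = _ := by ring

lemma jap_mul_succ_le {c : ℝ} (hc : 0 < c) (n : ℕ) :
    jap (c * (n + 1)) ≤ 2 / c * ((√(1 + c * n))⁻¹ - (√(1 + c * (n + 1)))⁻¹) := by
  set x := √(1 + c * n) with hx
  set y := √(1 + c * (n + 1)) with hy
  have hA : 0 < 1 + c * (n : ℝ) := by positivity
  have hB : 0 < 1 + c * ((n : ℝ) + 1) := by positivity
  have hx0 : 0 < x := Real.sqrt_pos.2 hA
  have hy0 : 0 < y := Real.sqrt_pos.2 hB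
  have hxx : x ^ 2 = 1 + c * n := Real.sq_sqrt hA.le
  have hyy : y ^ 2 = 1 + c * (n + 1) := Real.sq_sqrt hB.le
  have hxy : x ≤ y := Real.sqrt_le_sqrt (by nlinarith)
  have hj : jap (c * (n + 1)) = (y ^ 3)⁻¹ := by
    rw [jap, abs_of_nonneg (by positivity), Real.rpow_neg hB.le, hy, Real.sqrt_eq_rpow,
      ← Real.rpow_natCast, ← Real.rpow_mul hB.le]
    norm_num
  have hc' : c = y ^ 2 - x ^ 2 := by rw [hxx, hyy]; ring
  have hd : x⁻¹ - y⁻¹ = (y - x) / (x * y) := by field_simp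
  rw [hj, hd]
  have hyx : 0 < y - x := by
    have : 0 < (y - x) * (y + x) := by nlinarith
    exact (pos_iff_pos_of_mul_pos this).2 (by linarith)
  have h2 : 2 / c * ((y - x) / (x * y)) = 2 / ((y + x) * (x * y)) := by
    rw [hc', show y ^ 2 - x ^ 2 = (y + x) * (y - x) by ring]
    field_simp
  rw [h2, inv_eq_one_div, div_le_div_iff₀ (by positivity) (by positivity)]
  have h3 : x * (y + x) ≤ y * (y + y) := by gcongr
  nlinarith [mul_le_mul_of_nonneg_right h3 hy0.le]

lemma tsum_nat_jap_le {c : ℝ} (hc : 0 < c) :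
    ∑' n : ℕ, ENNReal.ofReal (jap (c * (n + 1))) ≤ ENNReal.ofReal (2 / c) := by
  refine ENNReal.tsum_le_of_sum_range_le fun N => ?_
  rw [← ENNReal.ofReal_sum_of_nonneg fun n _ => jap_nonneg _]
  refine ENNReal.ofReal_le_ofReal ?_
  have h : ∑ n ∈ Finset.range N, ((√(1 + c * n))⁻¹ - (√(1 + c * (n + 1)))⁻¹) =
      1 - (√(1 + c * N))⁻¹ := by
    have := Finset.sum_range_sub' (fun n : ℕ => (√(1 + c * n))⁻¹) N
    simpa using this
  calc ∑ n ∈ Finset.range N, jap (c * (n + 1))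
      ≤ ∑ n ∈ Finset.range N, 2 / c * ((√(1 + c * n))⁻¹ - (√(1 + c * (n + 1)))⁻¹) :=
        Finset.sum_le_sum fun n _ => jap_mul_succ_le hc n
    _ = 2 / c * (1 - (√(1 + c * N))⁻¹) := by rw [← Finset.mul_sum, h]
    _ ≤ 2 / c * 1 := by
        gcongr
        linarith [inv_nonneg.2 (Real.sqrt_nonneg (1 + c * N))]
    _ = 2 / c := mul_one _

lemma tsum_int_ne_zero_jap_le {c : ℝ} (hc : 0 < c) :
    ∑' n : ℤ, (if n = 0 then 0 else ENNReal.ofReal (jap (c * n))) ≤ ENNReal.ofReal (4 / c) := by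
  have hsum : ∑' n : ℤ, (if n = 0 then 0 else ENNReal.ofReal (jap (c * n))) =
      ∑' n : ℕ, ENNReal.ofReal (jap (c * (n + 1))) +
        ∑' n : ℕ, ENNReal.ofReal (jap (c * (n + 1))) := by
    rw [tsum_of_nat_of_neg_add_one ENNReal.summable ENNReal.summable]
    congr 1
    · rw [tsum_eq_zero_add' ENNReal.summable]
      simp only [Nat.cast_zero, if_true, zero_add]
      refine tsum_congr fun n => ?_
      rw [if_neg (by omega)]
      push_cast
      rfl
    · refine tsum_congr fun n => ?_
      rw [if_neg (by omega)]
      push_cast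
      congr 1
      rw [jap, jap, mul_neg, abs_neg]
  rw [hsum]
  refine (add_le_add (tsum_nat_jap_le hc) (tsum_nat_jap_le hc)).trans (le_of_eq ?_)
  rw [← ENNReal.ofReal_add (by positivity) (by positivity)]
  congr 1
  ring

lemma tsum_int_jap_le {c : ℝ} (hc : 0 < c) :
    ∑' n : ℤ, ENNReal.ofReal (jap (c * n)) ≤ ENNReal.ofReal (1 + 4 / c) := by
  have : ∀ n : ℤ, ENNReal.ofReal (jap (c * n)) =
      (if n = 0 then 1 else 0) + (if n = 0 then 0 else ENNReal.ofReal (jap (c * n))) := by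
    intro n
    split_ifs with h <;> simp [h, jap]
  rw [tsum_congr this, ENNReal.tsum_add, tsum_ite_eq, ENNReal.ofReal_add zero_le_one (by positivity),
    ENNReal.ofReal_one]
  gcongr
  exact tsum_int_ne_zero_jap_le hc

lemma decayWt_le_jap_of_le {M t u : ℝ} (hM : 0 < M) (h : u ≤ |t|) (hu : 0 ≤ u) :
    decayWt M t ≤ 4 * jap (u / M) := by
  have h0 : 0 ≤ min 1 (M / (1 + |t|)) := le_min zero_le_one (by positivity)
  have h1 : min 1 (M / (1 + |t|)) ≤ 2 / (1 + |u / M|) := by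
    rw [abs_of_nonneg (show 0 ≤ u / M by positivity)]
    rcases le_total (u / M) 1 with h2 | h2
    · refine (min_le_left _ _).trans ?_
      rw [le_div_iff₀ (by positivity)]
      linarith
    · refine (min_le_right _ _).trans ?_
      rw [div_le_div_iff₀ (by positivity) (by positivity)]
      have h3 : M * (1 + u / M) = M + u := by field_simp
      have h4 : M ≤ u := by rwa [le_div_iff₀ hM, one_mul] at h2
      rw [h3]
      linarith
  calc decayWt M t ≤ (2 / (1 + |u / M|)) ^ (3 / 2 : ℝ) := Real.rpow_le_rpow h0 h1 (by norm_num)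
    _ = 2 ^ (3 / 2 : ℝ) * jap (u / M) := by
        rw [Real.div_rpow (by norm_num) (by positivity), jap, Real.rpow_neg (by positivity),
          div_eq_mul_inv]
    _ ≤ 4 * jap (u / M) := by
        have : (2 : ℝ) ^ (3 / 2 : ℝ) ≤ 2 ^ (2 : ℝ) :=
          Real.rpow_le_rpow_of_exponent_le (by norm_num) (by norm_num)
        have h4 : (2 : ℝ) ^ (2 : ℝ) = 4 := by norm_num
        rw [h4] at this
        exact mul_le_mul_of_nonneg_right this (jap_nonneg _)

lemma tsum_decayWt_le {M L : ℝ} (hM : 0 < M) (hL : 0 < L) (c : ℝ) :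
    ∑' n : ℤ, ENNReal.ofReal (decayWt M (L * n + c)) ≤ ENNReal.ofReal (32 * (1 + M / L)) := by
  set h : ℤ := round (-c / L) with hh
  rw [← (Equiv.addRight h).tsum_eq]
  have hterm : ∀ n : ℤ, ENNReal.ofReal (decayWt M (L * (Equiv.addRight h n : ℤ) + c)) ≤
      ENNReal.ofReal 4 * ENNReal.ofReal (jap (L / (2 * M) * n)) := by
    intro n
    rw [← ENNReal.ofReal_mul (by norm_num)]
    refine ENNReal.ofReal_le_ofReal ?_
    have h1 : L * |(n : ℝ)| / 2 ≤ |L * ((Equiv.addRight h n : ℤ) : ℝ) + c| := by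
      rcases eq_or_ne n 0 with rfl | hn
      · simp
      · have hn1 : (1 : ℝ) ≤ |(n : ℝ)| := by exact_mod_cast Int.one_le_abs hn
        have h2 : |(-c / L) - h| ≤ 1 / 2 := abs_sub_round _
        have h3 : L * ((Equiv.addRight h n : ℤ) : ℝ) + c = L * (n - ((-c / L) - h)) := by
          simp only [Equiv.coe_addRight, Int.cast_add]
          field_simp
          ring
        rw [h3, abs_mul, abs_of_pos hL, mul_div_assoc]
        gcongr
        have := abs_sub_abs_le_abs_sub (n : ℝ) ((-c / L) - h)
        linarith
    refine (decayWt_le_jap_of_le hM h1 (by positivity)).trans (le_of_eq ?_)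
    congr 1
    have : L * |(n : ℝ)| / 2 / M = L / (2 * M) * |(n : ℝ)| := by field_simp
    rw [this, jap, jap, abs_mul, abs_mul, abs_abs]
  refine (ENNReal.tsum_le_tsum hterm).trans ?_
  rw [ENNReal.tsum_mul_left]
  refine (mul_le_mul_right (tsum_int_jap_le (c := L / (2 * M)) (by positivity)) _).trans ?_
  rw [← ENNReal.ofReal_mul (by norm_num)]
  refine ENNReal.ofReal_le_ofReal ?_
  have : 4 / (L / (2 * M)) = 8 * (M / L) := by field_simp; norm_num
  rw [this]
  linarith

lemma lintegral_tsum_jap_le {L c : ℝ} (hL : 0 < L) (hc : |c| ≤ L / 4) (a : ℝ) :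
    ∫⁻ s : ℝ, ∑' n : ℤ, (if n = 0 then 0 else
      ENNReal.ofReal (jap s * jap (L * n + c + s * a))) ≤
      ENNReal.ofReal (24 * japMass / L) := by
  have hpt : ∀ (s : ℝ) (n : ℤ), (if n = 0 then 0 else
      ENNReal.ofReal (jap s * jap (L * n + c + s * a))) ≤
      ENNReal.ofReal (jap s) * (if n = 0 then 0 else ENNReal.ofReal (jap (L / 4 * n))) +
      (if a = 0 then 0 else (if n = 0 then 0 else ENNReal.ofReal (jap (L / (2 * |a|) * n))) *
        ENNReal.ofReal (jap (L * n + c + a * s))) := by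
    intro s n
    rcases eq_or_ne n 0 with rfl | hn
    · simp
    have hn1 : (1 : ℝ) ≤ |(n : ℝ)| := by exact_mod_cast Int.one_le_abs hn
    rw [if_neg hn, if_neg hn, if_neg hn]
    have h1 : L * |(n : ℝ)| - L / 4 * |(n : ℝ)| - |s * a| ≤ |L * n + c + s * a| := by
      have h2 : L * n = (L * n + c + s * a) - c - s * a := by ring
      have h3 : L * |(n : ℝ)| ≤ |L * n + c + s * a| + |c| + |s * a| := by
        rw [← abs_of_pos hL, ← abs_mul, abs_of_pos hL]
        conv_lhs => rw [h2]
        exact (abs_sub _ _).trans (add_le_add_left (abs_sub _ _) _)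
      have h4 : L / 4 * 1 ≤ L / 4 * |(n : ℝ)| := by gcongr
      linarith
    rcases le_total (L / 2 * |(n : ℝ)|) |s * a| with h | h
    · have ha : a ≠ 0 := by
        rintro rfl
        simp only [mul_zero, abs_zero] at h
        nlinarith
      refine le_add_left ?_
      rw [if_neg ha, ← ENNReal.ofReal_mul (jap_nonneg _), mul_comm s a]
      refine ENNReal.ofReal_le_ofReal (mul_le_mul_of_nonneg_right (jap_le_jap ?_) (jap_nonneg _))
      have ha' : 0 < |a| := abs_pos.2 ha
      rw [abs_mul] at h
      rw [abs_mul, abs_of_pos (by positivity : 0 < L / (2 * |a|)), div_mul_eq_mul_div,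
        div_le_iff₀ (by positivity)]
      linarith
    · refine le_add_right ?_
      rw [← ENNReal.ofReal_mul (jap_nonneg _)]
      refine ENNReal.ofReal_le_ofReal (mul_le_mul_of_nonneg_left (jap_le_jap ?_) (jap_nonneg _))
      rw [abs_mul, abs_of_pos (by positivity : 0 < L / 4)]
      linarith
  have hmeas : Measurable fun s => ENNReal.ofReal (jap s) :=
    continuous_jap.measurable.ennreal_ofReal
  have hmeas' : ∀ n : ℤ, Measurable fun s => ENNReal.ofReal (jap (L * n + c + a * s)) :=
    fun n => (continuous_jap.comp (by fun_prop)).measurable.ennreal_ofReal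
  have hK := japMass_nonneg
  have hI : ∫⁻ s, ENNReal.ofReal (jap s) = ENNReal.ofReal japMass := by
    simpa using lintegral_jap_affine one_ne_zero 0
  have hA : ∫⁻ s : ℝ, ∑' n : ℤ, ENNReal.ofReal (jap s) *
      (if n = 0 then 0 else ENNReal.ofReal (jap (L / 4 * n))) ≤
      ENNReal.ofReal (16 * japMass / L) := by
    simp only [ENNReal.tsum_mul_left]
    rw [lintegral_mul_const _ hmeas, hI]
    refine (mul_le_mul_right (tsum_int_ne_zero_jap_le (c := L / 4) (by positivity)) _).trans ?_
    rw [← ENNReal.ofReal_mul hK]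
    refine ENNReal.ofReal_le_ofReal (le_of_eq ?_)
    field_simp
    norm_num
  have hB : ∫⁻ s : ℝ, ∑' n : ℤ, (if a = 0 then 0 else
      (if n = 0 then 0 else ENNReal.ofReal (jap (L / (2 * |a|) * n))) *
        ENNReal.ofReal (jap (L * n + c + a * s))) ≤ ENNReal.ofReal (8 * japMass / L) := by
    rcases eq_or_ne a 0 with ha | ha
    · simp [ha]
    have ha' : 0 < |a| := abs_pos.2 ha
    simp only [if_neg ha]
    rw [lintegral_tsum fun n => ((hmeas' n).const_mul _).aemeasurable]
    simp only [lintegral_const_mul _ (hmeas' _), lintegral_jap_affine ha]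
    rw [ENNReal.tsum_mul_right]
    refine (mul_le_mul_left
      (tsum_int_ne_zero_jap_le (c := L / (2 * |a|)) (by positivity)) _).trans ?_
    rw [← ENNReal.ofReal_mul (by positivity)]
    refine ENNReal.ofReal_le_ofReal (le_of_eq ?_)
    field_simp
    ring
  calc ∫⁻ s : ℝ, ∑' n : ℤ, (if n = 0 then 0 else
      ENNReal.ofReal (jap s * jap (L * n + c + s * a)))
      ≤ ∫⁻ s : ℝ, (∑' n : ℤ, ENNReal.ofReal (jap s) *
          (if n = 0 then 0 else ENNReal.ofReal (jap (L / 4 * n))) +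
        ∑' n : ℤ, (if a = 0 then 0 else
          (if n = 0 then 0 else ENNReal.ofReal (jap (L / (2 * |a|) * n))) *
            ENNReal.ofReal (jap (L * n + c + a * s)))) := by
        refine lintegral_mono fun s => ?_
        rw [← ENNReal.tsum_add]
        exact ENNReal.tsum_le_tsum fun n => hpt s n
    _ = _ + _ := lintegral_add_left (Measurable.tsum fun n => hmeas.mul_const _) _
    _ ≤ ENNReal.ofReal (16 * japMass / L) + ENNReal.ofReal (8 * japMass / L) := add_le_add hA hB
    _ = ENNReal.ofReal (24 * japMass / L) := by
        rw [← ENNReal.ofReal_add (by positivity) (by positivity)]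
        congr 1
        ring

end Estimates

section LatticeSums

variable {d : ℕ}

lemma tsum_pi_prod : ∀ {n : ℕ} (u : Fin n → ℤ → ℝ≥0∞),
    ∑' q : Fin n → ℤ, ∏ j, u j (q j) = ∏ j, ∑' m, u j m
  | 0, u => by simp
  | n + 1, u => by
    rw [← (Fin.consEquiv fun _ : Fin (n + 1) => ℤ).tsum_eq, ENNReal.tsum_prod',
      Fin.prod_univ_succ, ← tsum_pi_prod fun j => u j.succ, ← ENNReal.tsum_mul_right]
    refine tsum_congr fun m => ?_
    rw [← ENNReal.tsum_mul_left]
    refine tsum_congr fun q => ?_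
    simp [Fin.prod_univ_succ, Fin.consEquiv]

lemma tsum_pi_prod_ne_zero_le (u : Fin d → ℤ → ℝ≥0∞) {S : ℝ≥0∞} (hS : ∀ j, ∑' m, u j m ≤ S)
    (i : Fin d) :
    ∑' q : Fin d → ℤ, (if q i = 0 then 0 else ∏ j, u j (q j)) ≤
      (∑' m, if m = 0 then 0 else u i m) * S ^ (d - 1) := by
  set w : Fin d → ℤ → ℝ≥0∞ := Function.update u i fun m => if m = 0 then 0 else u i m with hw
  have hwi : w i = fun m => if m = 0 then 0 else u i m := Function.update_self ..
  have hwj : ∀ j ∈ Finset.univ.erase i, w j = u j := fun j hj =>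
    Function.update_of_ne (Finset.ne_of_mem_erase hj) ..
  have h : ∀ q : Fin d → ℤ, (if q i = 0 then 0 else ∏ j, u j (q j)) = ∏ j, w j (q j) := by
    intro q
    rw [← Finset.mul_prod_erase _ _ (Finset.mem_univ i),
      ← Finset.mul_prod_erase _ (fun j => w j (q j)) (Finset.mem_univ i), hwi,
      Finset.prod_congr rfl fun j hj => congrFun (hwj j hj) (q j)]
    by_cases h0 : q i = 0 <;> simp [h0]
  rw [tsum_congr h, tsum_pi_prod, ← Finset.mul_prod_erase _ _ (Finset.mem_univ i), hwi]
  gcongr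
  calc ∏ j ∈ Finset.univ.erase i, ∑' m, w j m ≤ ∏ _j ∈ Finset.univ.erase i, S :=
        Finset.prod_le_prod' fun j hj => by rw [hwj j hj]; exact hS j
    _ = S ^ (d - 1) := by simp [Finset.card_erase_of_mem]

lemma tsum_pair_prod_le (u v : Fin d → ℤ → ℝ≥0∞) {S : ℝ≥0∞} (hu : ∀ j, ∑' m, u j m ≤ S)
    (hv : ∀ j, ∑' m, v j m ≤ S) :
    ∑' q : (Fin d → ℤ) × (Fin d → ℤ), (∏ j, u j (q.1 j)) * ∏ j, v j (q.2 j) ≤ S ^ (2 * d) := by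
  rw [ENNReal.tsum_prod']
  simp only [ENNReal.tsum_mul_left, ENNReal.tsum_mul_right, tsum_pi_prod]
  rw [two_mul, pow_add]
  gcongr
  · exact (Finset.prod_le_prod' fun j _ => hu j).trans (by simp)
  · exact (Finset.prod_le_prod' fun j _ => hv j).trans (by simp)

lemma tsum_pair_prod_ne_zero_le (u v : Fin d → ℤ → ℝ≥0∞) {S : ℝ≥0∞}
    (hu : ∀ j, ∑' m, u j m ≤ S) (hv : ∀ j, ∑' m, v j m ≤ S) :
    ∑' q : {q : (Fin d → ℤ) × (Fin d → ℤ) // q ≠ 0},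
      (∏ j, u j (q.1.1 j)) * ∏ j, v j (q.1.2 j) ≤
      S ^ (2 * d - 1) *
        ∑ i, ((∑' m, if m = 0 then 0 else u i m) + ∑' m, if m = 0 then 0 else v i m) := by
  set F : (Fin d → ℤ) × (Fin d → ℤ) → ℝ≥0∞ := fun q =>
    ∑ i, ((if q.1 i = 0 then 0 else ∏ j, u j (q.1 j)) * ∏ j, v j (q.2 j) +
      (∏ j, u j (q.1 j)) * (if q.2 i = 0 then 0 else ∏ j, v j (q.2 j))) with hF
  have hpt : ∀ q : {q : (Fin d → ℤ) × (Fin d → ℤ) // q ≠ 0},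
      (∏ j, u j (q.1.1 j)) * ∏ j, v j (q.1.2 j) ≤ F q.1 := by
    rintro ⟨⟨g, h⟩, hne⟩
    simp only [hF]
    have : ∃ i, g i ≠ 0 ∨ h i ≠ 0 := by
      by_contra! hc
      exact hne (Prod.ext (funext fun i => (hc i).1) (funext fun i => (hc i).2))
    obtain ⟨i, hi⟩ := this
    refine le_trans ?_ (Finset.single_le_sum (fun _ _ => zero_le) (Finset.mem_univ i))
    rcases hi with hi | hi
    · exact le_add_right (by rw [if_neg hi])
    · exact le_add_left (by rw [if_neg hi])
  refine (ENNReal.tsum_le_tsum hpt).trans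
    ((ENNReal.tsum_comp_le_tsum_of_injective Subtype.val_injective F).trans ?_)
  rw [hF, Summable.tsum_finsetSum fun _ _ => ENNReal.summable, Finset.mul_sum]
  refine Finset.sum_le_sum fun i _ => ?_
  have hd : 2 * d - 1 = (d - 1) + d := by have := i.pos; omega
  have hu' : ∏ j, ∑' m, u j m ≤ S ^ d := (Finset.prod_le_prod' fun j _ => hu j).trans (by simp)
  have hv' : ∏ j, ∑' m, v j m ≤ S ^ d := (Finset.prod_le_prod' fun j _ => hv j).trans (by simp)
  rw [ENNReal.tsum_add, ENNReal.tsum_prod', ENNReal.tsum_prod', mul_add]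
  simp only [ENNReal.tsum_mul_left, ENNReal.tsum_mul_right, tsum_pi_prod]
  refine add_le_add ?_ ?_
  · refine (mul_le_mul' (tsum_pi_prod_ne_zero_le u hu i) hv').trans (le_of_eq ?_)
    rw [hd, pow_add]
    ring
  · refine (mul_le_mul' hu' (tsum_pi_prod_ne_zero_le v hv i)).trans (le_of_eq ?_)
    rw [hd, pow_add]
    ring

end LatticeSums

section TermBound

variable {d : ℕ}

/-- The dimensional constant in the pointwise bound for the oscillatory integrals. -/
def termConst (d : ℕ) (M : ℝ) : ℝ :=
  M ^ d * (2 ^ (5 * d) * (2 ^ (5 * d) * M) ^ d) * 64 ^ d * (4 + 2 * japMass) ^ d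

lemma termConst_nonneg {M : ℝ} (hM : 0 ≤ M) (d : ℕ) : 0 ≤ termConst d M := by
  have := japMass_nonneg
  unfold termConst
  positivity

lemma norm_bilinOsc_le_decayWt_sq {χ : ℝ → ℝ} {M D lam : ℝ} (hχ : ContDiff ℝ (⊤ : ℕ∞) χ)
    (hχ0 : ∀ z : ℝ, 1 ≤ |z| → χ z = 0) (hM : CutoffBound χ (5 * d) M) (hlam : 1 ≤ lam)
    {Φ : EuclideanSpace ℝ (Fin d) → EuclideanSpace ℝ (Fin d) → ℂ}
    (hΦ : ContDiff ℝ (5 * d : ℕ)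
      fun p : EuclideanSpace ℝ (Fin d) × EuclideanSpace ℝ (Fin d) => Φ p.1 p.2)
    (hD : ∀ x, DerivBound (5 * d) D (Φ x)) (a b : EuclideanSpace ℝ (Fin d)) (k l : Fin d → ℝ)
    (s : ℝ) :
    ‖bilinOsc χ lam a b k l s Φ‖ ≤
      termConst d M * D * lam ^ (2 * d) * ((1 + |s|) ^ d)⁻¹ *
        (∏ i, decayWt (lam * (1 + |s|)) (l i + s * a i)) ^ 2 := by
  have hM0 : 0 ≤ M := (norm_nonneg _).trans (hM 0 (by simp) 0)
  have hD0 := (hD 0).nonneg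
  have hK := japMass_nonneg
  refine (norm_bilinOsc_le hχ hχ0 hM hlam hΦ hD a b k l s).trans ?_
  calc _ ≤ M ^ d * (2 ^ (5 * d) * ((2 ^ (5 * d) * M) ^ d * D) * (64 * lam) ^ d) *
        ∏ i, ((4 + 2 * japMass) * (lam / (1 + |s|)) *
          decayWt (lam * (1 + |s|)) (l i + s * a i) ^ 2) := by
        gcongr with i
        exact setIntegral_inv_pow_le hlam (a i) (l i) s
    _ = _ := by
        rw [Finset.prod_mul_distrib, Finset.prod_pow, Finset.prod_const, Finset.card_univ,
          Fintype.card_fin, termConst, mul_pow (4 + 2 * japMass), div_pow, mul_pow 64 lam, two_mul d,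
          pow_add lam d d]
        ring

lemma norm_bilinOsc_le_decayWt {χ : ℝ → ℝ} {M D lam : ℝ} (hχ : ContDiff ℝ (⊤ : ℕ∞) χ)
    (hχ0 : ∀ z : ℝ, 1 ≤ |z| → χ z = 0) (hM : CutoffBound χ (5 * d) M) (hlam : 1 ≤ lam)
    {Φ : EuclideanSpace ℝ (Fin d) → EuclideanSpace ℝ (Fin d) → ℂ}
    (hΦ : ContDiff ℝ (5 * d : ℕ)
      fun p : EuclideanSpace ℝ (Fin d) × EuclideanSpace ℝ (Fin d) => Φ p.1 p.2)
    (hD : ∀ x, DerivBound (5 * d) D (Φ x)) (hD' : ∀ y, DerivBound (5 * d) D fun x => Φ x y)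
    (a b : EuclideanSpace ℝ (Fin d)) (k l : Fin d → ℝ) (s : ℝ) :
    ‖bilinOsc χ lam a b k l s Φ‖ ≤
      termConst d M * D * lam ^ (2 * d) * ((1 + |s|) ^ d)⁻¹ *
        ((∏ i, decayWt (lam * (1 + |s|)) (k i + s * b i)) *
          ∏ i, decayWt (lam * (1 + |s|)) (l i + s * a i)) := by
  have hM0 : 0 ≤ M := (norm_nonneg _).trans (hM 0 (by simp) 0)
  have hT := termConst_nonneg hM0 d
  have hD0 := (hD 0).nonneg
  have hm : 0 ≤ lam * (1 + |s|) := by positivity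
  have h1 := norm_bilinOsc_le_decayWt_sq hχ hχ0 hM hlam hΦ hD a b k l s
  have h2 := norm_bilinOsc_le_decayWt_sq hχ hχ0 hM hlam (Φ := fun y x => Φ x y)
    (hΦ.comp (contDiff_snd.prodMk contDiff_fst)) hD' b a l k s
  rw [bilinOsc_swap] at h2
  set A := termConst d M * D * lam ^ (2 * d) * ((1 + |s|) ^ d)⁻¹
  set P := ∏ i, decayWt (lam * (1 + |s|)) (k i + s * b i)
  set Q := ∏ i, decayWt (lam * (1 + |s|)) (l i + s * a i)
  have hA : 0 ≤ A := by positivity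
  have hP : 0 ≤ P := Finset.prod_nonneg fun i _ => decayWt_nonneg hm _
  have hQ : 0 ≤ Q := Finset.prod_nonneg fun i _ => decayWt_nonneg hm _
  refine (pow_le_pow_iff_left₀ (norm_nonneg _) (by positivity) two_ne_zero).1 ?_
  calc ‖bilinOsc χ lam a b k l s Φ‖ ^ 2
      = ‖bilinOsc χ lam a b k l s Φ‖ * ‖bilinOsc χ lam a b k l s Φ‖ := sq _
    _ ≤ (A * P ^ 2) * (A * Q ^ 2) := mul_le_mul h2 h1 (norm_nonneg _) (by positivity)
    _ = (A * (P * Q)) ^ 2 := by ring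

/-- The weight `decayWt`, shifted and with values in `ℝ≥0∞`, on the `n`-th lattice point. -/
def latticeWt (lam L s c a : ℝ) (n : ℤ) : ℝ≥0∞ :=
  ENNReal.ofReal (decayWt (lam * (1 + |s|)) (L * n + (c + s * a)))

lemma enorm_oscInt_le {χ : ℝ → ℝ} {M D lam : ℝ} (hχ : ContDiff ℝ (⊤ : ℕ∞) χ)
    (hχ0 : ∀ z : ℝ, 1 ≤ |z| → χ z = 0) (hM : CutoffBound χ (5 * d) M) (hlam : 1 ≤ lam)
    {Φ : ℝ → EuclideanSpace ℝ (Fin d) → EuclideanSpace ℝ (Fin d) → ℂ}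
    (hΦ : ∀ s : ℝ, ContDiff ℝ (20 * d : ℕ)
      fun p : EuclideanSpace ℝ (Fin d) × EuclideanSpace ℝ (Fin d) => Φ s p.1 p.2)
    (hD : PhiDerivBound d D Φ) (L s : ℝ) (a b ξ ζ : EuclideanSpace ℝ (Fin d))
    (g h : Fin d → ℤ) :
    ‖oscInt d χ Φ lam L s a b ξ ζ g h‖ₑ ≤
      ENNReal.ofReal (termConst d M * D * lam ^ (2 * d) * ((1 + |s|) ^ d)⁻¹) *
        ((∏ i, latticeWt lam L s (ξ i) (b i) (g i)) *
          ∏ i, latticeWt lam L s (ζ i) (a i) (h i)) := by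
  have hm : 0 ≤ lam * (1 + |s|) := by positivity
  have hM0 : 0 ≤ M := (norm_nonneg _).trans (hM 0 (by simp) 0)
  have hT := termConst_nonneg hM0 d
  have hD1 : ∀ x, DerivBound (5 * d) D (Φ s x) := fun x l hl y =>
    hD [] l (by simp) (by omega) s x y
  have hD2 : ∀ y, DerivBound (5 * d) D fun x => Φ s x y := fun y l hl x =>
    hD l [] (by omega) (by simp) s x y
  have hD0 := (hD1 0).nonneg
  have heq : oscInt d χ Φ lam L s a b ξ ζ g h =
      bilinOsc χ lam a b (fun i => L * g i + ξ i) (fun i => L * h i + ζ i) s (Φ s) := by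
    simp only [oscInt, bilinOsc, linForm_apply]
  simp only [latticeWt]
  rw [heq, ← ENNReal.ofReal_prod_of_nonneg fun i _ => decayWt_nonneg hm _,
    ← ENNReal.ofReal_prod_of_nonneg fun i _ => decayWt_nonneg hm _,
    ← ENNReal.ofReal_mul (Finset.prod_nonneg fun i _ => decayWt_nonneg hm _),
    ← ENNReal.ofReal_mul (by positivity), ← ofReal_norm]
  refine ENNReal.ofReal_le_ofReal ?_
  have := norm_bilinOsc_le_decayWt hχ hχ0 hM hlam
    ((hΦ s).of_le (by norm_cast; omega)) hD1 hD2 a b (fun i => L * g i + ξ i)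
    (fun i => L * h i + ζ i) s
  simpa only [add_assoc] using this

lemma oscInt_eq_zero {χ : ℝ → ℝ}
    {Φ : ℝ → EuclideanSpace ℝ (Fin d) → EuclideanSpace ℝ (Fin d) → ℂ} {s : ℝ}
    (h : ∀ x y, Φ s x y = 0) (lam L : ℝ) (a b ξ ζ : EuclideanSpace ℝ (Fin d))
    (g k : Fin d → ℤ) : oscInt d χ Φ lam L s a b ξ ζ g k = 0 := by
  simp [oscInt, h]

end TermBound

section ScalarBounds

lemma inv_pow_le_jap {d : ℕ} (hd : 2 ≤ d) (s : ℝ) : ((1 + |s|) ^ d)⁻¹ ≤ jap s := by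
  have h1 : 1 ≤ 1 + |s| := by linarith [abs_nonneg s]
  rw [jap, ← Real.rpow_natCast, ← Real.rpow_neg (by linarith)]
  refine Real.rpow_le_rpow_of_exponent_le h1 ?_
  have : (2 : ℝ) ≤ d := by exact_mod_cast hd
  linarith

lemma inv_pow_mul_rpow_le_jap {d : ℕ} (hd : 3 ≤ d) (s : ℝ) :
    ((1 + |s|) ^ d)⁻¹ * (1 + |s|) ^ (3 / 2 : ℝ) ≤ jap s := by
  have h1 : 1 ≤ 1 + |s| := by linarith [abs_nonneg s]
  rw [jap, ← Real.rpow_natCast, ← Real.rpow_neg (by linarith), ← Real.rpow_add (by linarith)]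
  refine Real.rpow_le_rpow_of_exponent_le h1 ?_
  have : (3 : ℝ) ≤ d := by exact_mod_cast hd
  linarith

lemma lattice_mass_le {d : ℕ} (hd : 3 ≤ d) {κ lam L K s : ℝ} (hκ : 1 ≤ κ) (hlam : 1 ≤ lam)
    (hL : 1 ≤ L) (hK : 0 ≤ K) (hlamL : lam ^ (2 * d) ≤ K * L) (hs : |s| ≤ κ * L) :
    ((1 + |s|) ^ d)⁻¹ * (32 * (1 + lam * (1 + |s|) / L)) ^ (2 * d) ≤
      64 ^ (2 * d) * (1 + K * (2 * κ) ^ (d + 2)) * jap s := by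
  set σ := 1 + |s| with hσ
  have hσ1 : 1 ≤ σ := by linarith [abs_nonneg s]
  have hσL : σ ≤ 2 * κ * L := by nlinarith
  have hL0 : 0 < L := by linarith
  have hj := jap_nonneg s
  set x := lam * σ / L with hx
  have hx0 : 0 ≤ x := by positivity
  have h1 : (1 + x) ^ (2 * d) ≤ 2 ^ (2 * d) * (1 + x ^ (2 * d)) := by
    rcases le_total x 1 with h | h
    · calc (1 + x) ^ (2 * d) ≤ 2 ^ (2 * d) := by gcongr; linarith
        _ ≤ 2 ^ (2 * d) * (1 + x ^ (2 * d)) := le_mul_of_one_le_right (by positivity)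
            (by linarith [pow_nonneg hx0 (2 * d)])
    · calc (1 + x) ^ (2 * d) ≤ (2 * x) ^ (2 * d) := by gcongr; linarith
        _ = 2 ^ (2 * d) * x ^ (2 * d) := mul_pow _ _ _
        _ ≤ 2 ^ (2 * d) * (1 + x ^ (2 * d)) := by gcongr; linarith
  have h2 : (σ ^ d)⁻¹ * x ^ (2 * d) ≤ K * (2 * κ) ^ (d + 2) * (σ ^ 2)⁻¹ := by
    have h3 : (σ ^ d)⁻¹ * x ^ (2 * d) =
        lam ^ (2 * d) * σ ^ (d + 2) / L ^ (2 * d) * (σ ^ 2)⁻¹ := by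
      rw [hx, div_pow, mul_pow]
      field_simp
      ring
    rw [h3]
    gcongr
    rw [div_le_iff₀ (by positivity)]
    calc lam ^ (2 * d) * σ ^ (d + 2) ≤ (K * L) * (2 * κ * L) ^ (d + 2) := by gcongr
      _ = K * (2 * κ) ^ (d + 2) * L ^ (d + 3) := by rw [mul_pow]; ring
      _ ≤ K * (2 * κ) ^ (d + 2) * L ^ (2 * d) := by
          gcongr
          omega
  calc (σ ^ d)⁻¹ * (32 * (1 + x)) ^ (2 * d)
      = 32 ^ (2 * d) * ((σ ^ d)⁻¹ * (1 + x) ^ (2 * d)) := by rw [mul_pow]; ring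
    _ ≤ 32 ^ (2 * d) * ((σ ^ d)⁻¹ * (2 ^ (2 * d) * (1 + x ^ (2 * d)))) := by gcongr
    _ = 64 ^ (2 * d) * ((σ ^ d)⁻¹ + (σ ^ d)⁻¹ * x ^ (2 * d)) := by
        rw [show (64 : ℝ) = 32 * 2 by norm_num, mul_pow]
        ring
    _ ≤ 64 ^ (2 * d) * (jap s + K * (2 * κ) ^ (d + 2) * jap s) := by
        refine mul_le_mul_of_nonneg_left (add_le_add (inv_pow_le_jap (by omega) s)
          (h2.trans ?_)) (by positivity)
        gcongr
        exact inv_pow_le_jap le_rfl s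
    _ = _ := by ring

lemma exists_log_pow_le (n : ℕ) (hn : 0 < n) {η : ℝ} (hη : 0 < η) :
    ∃ K : ℝ, 0 ≤ K ∧ ∀ L : ℝ, 1 ≤ L → Real.log L ^ n ≤ K * L ^ (2 * η) := by
  have hn' : (0 : ℝ) < n := by exact_mod_cast hn
  set ε : ℝ := 2 * η / n with hε
  have hε0 : 0 < ε := by positivity
  refine ⟨(ε⁻¹) ^ n, by positivity, fun L hL => ?_⟩
  have h1 := Real.log_le_rpow_div (by linarith : 0 ≤ L) hε0
  calc Real.log L ^ n ≤ (L ^ ε / ε) ^ n := by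
        gcongr
        exact Real.log_nonneg hL
    _ = ε⁻¹ ^ n * L ^ (2 * η) := by
        rw [div_eq_mul_inv, mul_pow, mul_comm, ← Real.rpow_natCast (L ^ ε),
          ← Real.rpow_mul (by linarith), hε, div_mul_cancel₀ _ hn'.ne']

end ScalarBounds

section PoissonSums

variable {d : ℕ}

lemma tsum_latticeWt_le {lam L : ℝ} (hlam : 1 ≤ lam) (hL : 0 < L) (s c a : ℝ) :
    ∑' n, latticeWt lam L s c a n ≤ ENNReal.ofReal (32 * (1 + lam * (1 + |s|) / L)) :=
  tsum_decayWt_le (by positivity) hL _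

/-- The total bound, with the zero frequency included. -/
lemma lintegral_tsum_enorm_oscInt_le (hd : 3 ≤ d) {χ : ℝ → ℝ} {M D lam L κ K : ℝ}
    (hχ : ContDiff ℝ (⊤ : ℕ∞) χ) (hχ0 : ∀ z : ℝ, 1 ≤ |z| → χ z = 0)
    (hM : CutoffBound χ (5 * d) M) (hlam : 1 ≤ lam) (hκ : 1 ≤ κ) (hL : 1 ≤ L) (hK : 0 ≤ K)
    (hD0 : 0 < D) (hlamL : lam ^ (2 * d) ≤ K * L)
    {Φ : ℝ → EuclideanSpace ℝ (Fin d) → EuclideanSpace ℝ (Fin d) → ℂ}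
    (hΦ : ∀ s : ℝ, ContDiff ℝ (20 * d : ℕ)
      fun p : EuclideanSpace ℝ (Fin d) × EuclideanSpace ℝ (Fin d) => Φ s p.1 p.2)
    (hD : PhiDerivBound d D Φ) (hsupp : ∀ s x y, κ * L < |s| → Φ s x y = 0)
    (a b ξ ζ : EuclideanSpace ℝ (Fin d)) :
    ∫⁻ s, ∑' q : (Fin d → ℤ) × (Fin d → ℤ), ‖oscInt d χ Φ lam L s a b ξ ζ q.1 q.2‖ₑ ≤
      ENNReal.ofReal (termConst d M * (64 ^ (2 * d) * (1 + K * (2 * κ) ^ (d + 2))) * japMass *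
        D * lam ^ (2 * d)) := by
  have hM0 : 0 ≤ M := (norm_nonneg _).trans (hM 0 (by simp) 0)
  have hT := termConst_nonneg hM0 d
  have hL0 : 0 < L := by linarith
  set B := termConst d M * D * lam ^ (2 * d) with hB
  set E := 64 ^ (2 * d) * (1 + K * (2 * κ) ^ (d + 2)) with hE
  have hB0 : 0 ≤ B := by positivity
  have hE0 : 0 ≤ E := by positivity
  have hpt : ∀ s : ℝ, ∑' q : (Fin d → ℤ) × (Fin d → ℤ),
      ‖oscInt d χ Φ lam L s a b ξ ζ q.1 q.2‖ₑ ≤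
      ENNReal.ofReal (B * E) * ENNReal.ofReal (jap s) := by
    intro s
    rcases lt_or_ge (κ * L) |s| with hs | hs
    · simp [oscInt_eq_zero fun x y => hsupp s x y hs]
    · refine (ENNReal.tsum_le_tsum fun q : (Fin d → ℤ) × (Fin d → ℤ) =>
        enorm_oscInt_le hχ hχ0 hM hlam hΦ hD L s a b ξ ζ q.1 q.2).trans ?_
      rw [ENNReal.tsum_mul_left]
      refine (mul_le_mul_right (tsum_pair_prod_le
        (fun j => latticeWt lam L s (ξ j) (b j)) (fun j => latticeWt lam L s (ζ j) (a j))
        (fun j => tsum_latticeWt_le hlam hL0 s (ξ j) (b j))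
        fun j => tsum_latticeWt_le hlam hL0 s (ζ j) (a j)) _).trans ?_
      rw [← ENNReal.ofReal_pow (by positivity), ← ENNReal.ofReal_mul (by positivity),
        ← ENNReal.ofReal_mul (by positivity)]
      refine ENNReal.ofReal_le_ofReal ?_
      rw [← hB, mul_assoc B, mul_assoc B]
      exact mul_le_mul_of_nonneg_left (lattice_mass_le hd hκ hlam hL hK hlamL hs) hB0
  refine (lintegral_mono hpt).trans ?_
  rw [lintegral_const_mul' _ _ ENNReal.ofReal_ne_top,
    ← ofReal_integral_eq_lintegral_ofReal integrable_jap (Filter.Eventually.of_forall jap_nonneg),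
    ← ENNReal.ofReal_mul (by positivity)]
  refine ENNReal.ofReal_le_ofReal (le_of_eq ?_)
  rw [← japMass, hB]
  ring

/-- The bound for nonzero frequencies, when the frequency shifts are small against `L`. -/
lemma lintegral_tsum_ne_zero_enorm_oscInt_le (hd : 3 ≤ d) {χ : ℝ → ℝ} {M D lam L κ : ℝ}
    (hχ : ContDiff ℝ (⊤ : ℕ∞) χ) (hχ0 : ∀ z : ℝ, 1 ≤ |z| → χ z = 0)
    (hM : CutoffBound χ (5 * d) M) (hlam : 1 ≤ lam) (hκ : 1 ≤ κ) (hL : 1 ≤ L) (hD0 : 0 < D)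
    {Φ : ℝ → EuclideanSpace ℝ (Fin d) → EuclideanSpace ℝ (Fin d) → ℂ}
    (hΦ : ∀ s : ℝ, ContDiff ℝ (20 * d : ℕ)
      fun p : EuclideanSpace ℝ (Fin d) × EuclideanSpace ℝ (Fin d) => Φ s p.1 p.2)
    (hD : PhiDerivBound d D Φ) (hsupp : ∀ s x y, κ * L < |s| → Φ s x y = 0)
    (a b : EuclideanSpace ℝ (Fin d)) {ξ ζ : EuclideanSpace ℝ (Fin d)}
    (hξ : ∀ i, |ξ i| ≤ L / 4) (hζ : ∀ i, |ζ i| ≤ L / 4) :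
    ∫⁻ s, ∑' q : {q : (Fin d → ℤ) × (Fin d → ℤ) // q ≠ 0},
      ‖oscInt d χ Φ lam L s a b ξ ζ q.1.1 q.1.2‖ₑ ≤
      ENNReal.ofReal (termConst d M * (96 * κ) ^ (2 * d) * (48 * d * japMass) *
        D * lam ^ (2 * d) * (lam ^ (2 * d + 2) / L)) := by
  have hM0 : 0 ≤ M := (norm_nonneg _).trans (hM 0 (by simp) 0)
  have hT := termConst_nonneg hM0 d
  have hL0 : 0 < L := by linarith
  have hJ := japMass_nonneg
  set B := termConst d M * D * lam ^ (2 * d) with hB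
  set E := (96 * κ) ^ (2 * d) * lam ^ (2 * d + 2) with hE
  have hB0 : 0 ≤ B := by positivity
  have hE0 : 0 ≤ E := by positivity
  set W : ℝ → ℝ → ℝ → ℝ≥0∞ := fun c a s => ∑' n : ℤ, (if n = 0 then 0 else
    ENNReal.ofReal (jap s * jap (L * n + c + s * a))) with hW
  have hWm : ∀ c a, Measurable (W c a) := fun c a => by
    refine Measurable.tsum fun n => ?_
    split_ifs
    · exact measurable_const
    · exact (continuous_jap.mul (continuous_jap.comp (by fun_prop))).measurable.ennreal_ofReal
  have hWpt : ∀ c a s : ℝ, |s| ≤ κ * L →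
      ENNReal.ofReal (B * ((1 + |s|) ^ d)⁻¹ * (32 * (1 + lam * (1 + |s|) / L)) ^ (2 * d - 1)) *
        (∑' n, if n = 0 then 0 else latticeWt lam L s c a n) ≤
      ENNReal.ofReal (B * E) * W c a s := by
    intro c a s hs
    rw [hW, ← ENNReal.tsum_mul_left, ← ENNReal.tsum_mul_left]
    refine ENNReal.tsum_le_tsum fun n => ?_
    split_ifs
    · simp
    rw [latticeWt, ← ENNReal.ofReal_mul (by positivity), ← ENNReal.ofReal_mul (by positivity),
      add_assoc]
    refine ENNReal.ofReal_le_ofReal ?_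
    set t := L * (n : ℝ) + (c + s * a)
    have hwt : 0 ≤ decayWt (lam * (1 + |s|)) t := decayWt_nonneg (by positivity) t
    set σ := 1 + |s| with hσ
    have hσ1 : 1 ≤ σ := by linarith [abs_nonneg s]
    have hjt := jap_nonneg t
    have hS : 32 * (1 + lam * σ / L) ≤ 96 * κ * lam := by
      have h1 : lam * σ / L ≤ 2 * κ * lam := by
        rw [div_le_iff₀ hL0]
        have : σ ≤ 2 * κ * L := by nlinarith
        nlinarith
      have h2 : 1 ≤ κ * lam := one_le_mul_of_one_le_of_one_le hκ hlam
      linarith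
    have h1 : decayWt (lam * σ) t ≤ lam ^ 2 * σ ^ (3 / 2 : ℝ) * jap t := by
      refine (decayWt_le_mul_jap (by positivity) t).trans ?_
      rw [Real.mul_rpow (by linarith) (by linarith)]
      gcongr
      rw [← Real.rpow_natCast]
      exact Real.rpow_le_rpow_of_exponent_le hlam (by norm_num)
    have h2 : (96 * κ * lam) ^ (2 * d - 1) ≤ (96 * κ * lam) ^ (2 * d) := by
      have : 1 ≤ κ * lam := one_le_mul_of_one_le_of_one_le hκ hlam
      exact pow_le_pow_right₀ (by linarith) (by omega)
    calc B * (σ ^ d)⁻¹ * (32 * (1 + lam * σ / L)) ^ (2 * d - 1) * decayWt (lam * σ) t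
        ≤ B * (σ ^ d)⁻¹ * (96 * κ * lam) ^ (2 * d - 1) *
          (lam ^ 2 * σ ^ (3 / 2 : ℝ) * jap t) := by
          gcongr
      _ ≤ B * (σ ^ d)⁻¹ * (96 * κ * lam) ^ (2 * d) *
          (lam ^ 2 * σ ^ (3 / 2 : ℝ) * jap t) := by
          gcongr
      _ = B * E * (((σ ^ d)⁻¹ * σ ^ (3 / 2 : ℝ)) * jap t) := by
          rw [hE, mul_pow (96 * κ)]
          ring
      _ ≤ B * E * (jap s * jap t) := by
          gcongr
          exact inv_pow_mul_rpow_le_jap hd s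
  have hpt : ∀ s : ℝ, ∑' q : {q : (Fin d → ℤ) × (Fin d → ℤ) // q ≠ 0},
      ‖oscInt d χ Φ lam L s a b ξ ζ q.1.1 q.1.2‖ₑ ≤
      ENNReal.ofReal (B * E) * ∑ i, (W (ξ i) (b i) s + W (ζ i) (a i) s) := by
    intro s
    rcases lt_or_ge (κ * L) |s| with hs | hs
    · simp [oscInt_eq_zero fun x y => hsupp s x y hs]
    · refine (ENNReal.tsum_le_tsum fun q : {q : (Fin d → ℤ) × (Fin d → ℤ) // q ≠ 0} =>
        enorm_oscInt_le hχ hχ0 hM hlam hΦ hD L s a b ξ ζ q.1.1 q.1.2).trans ?_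
      rw [ENNReal.tsum_mul_left]
      refine (mul_le_mul_right (tsum_pair_prod_ne_zero_le
        (fun j => latticeWt lam L s (ξ j) (b j)) (fun j => latticeWt lam L s (ζ j) (a j))
        (fun j => tsum_latticeWt_le hlam hL0 s (ξ j) (b j))
        fun j => tsum_latticeWt_le hlam hL0 s (ζ j) (a j)) _).trans ?_
      rw [← mul_assoc, ← ENNReal.ofReal_pow (by positivity),
        ← ENNReal.ofReal_mul (by positivity), Finset.mul_sum, Finset.mul_sum]
      refine Finset.sum_le_sum fun i _ => ?_
      rw [mul_add, mul_add (ENNReal.ofReal (B * E))]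
      exact add_le_add (hWpt _ _ s hs) (hWpt _ _ s hs)
  refine (lintegral_mono hpt).trans ?_
  rw [lintegral_const_mul' _ _ ENNReal.ofReal_ne_top,
    lintegral_finsetSum (f := fun i s => W (ξ i) (b i) s + W (ζ i) (a i) s) _
      fun i _ => (hWm _ _).add (hWm _ _)]
  have hsum : ∑ i, ∫⁻ s, (W (ξ i) (b i) s + W (ζ i) (a i) s) ≤
      ∑ _i : Fin d, ENNReal.ofReal (48 * japMass / L) := by
    refine Finset.sum_le_sum fun i _ => ?_
    rw [lintegral_add_left (hWm _ _)]
    refine (add_le_add (lintegral_tsum_jap_le hL0 (hξ i) (b i))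
      (lintegral_tsum_jap_le hL0 (hζ i) (a i))).trans (le_of_eq ?_)
    rw [← ENNReal.ofReal_add (by positivity) (by positivity)]
    congr 1
    ring
  refine (mul_le_mul_right hsum _).trans (le_of_eq ?_)
  rw [Finset.sum_const, Finset.card_univ, Fintype.card_fin, nsmul_eq_mul,
    ← ENNReal.ofReal_natCast, ← ENNReal.ofReal_mul (by positivity),
    ← ENNReal.ofReal_mul (by positivity)]
  congr 1
  rw [hB, hE]
  ring

end PoissonSums

theorem statement13 (d : ℕ) (hd : 3 ≤ d) (χ₀ : ℝ → ℝ)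
    (hχs : ContDiff ℝ (⊤ : ℕ∞) χ₀)
    (hχ1 : ∀ z : ℝ, |z| ≤ 1 / 2 → χ₀ z = 1)
    (hχ0 : ∀ z : ℝ, 1 ≤ |z| → χ₀ z = 0) :
    ∃ η₀ : ℝ, 0 < η₀ ∧ ∀ η : ℝ, 0 < η → η ≤ η₀ →
    ∀ κ : ℝ, 1 ≤ κ →
    ∃ C : ℝ, 1 ≤ C ∧
    ∀ L : ℝ, C ≤ L →
    ∀ lam : ℝ, 1 ≤ lam → lam ≤ Real.log L ^ 4 →
    ∀ D : ℝ, 0 < D →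
    ∀ Φ : ℝ → EuclideanSpace ℝ (Fin d) → EuclideanSpace ℝ (Fin d) → ℂ,
      (∀ s : ℝ, ContDiff ℝ (20 * d : ℕ)
        (fun p : EuclideanSpace ℝ (Fin d) × EuclideanSpace ℝ (Fin d) => Φ s p.1 p.2)) →
      PhiDerivBound d D Φ →
      (∀ (s : ℝ) (x y : EuclideanSpace ℝ (Fin d)), κ * L < |s| → Φ s x y = 0) →
    ∀ a b ξ ζ : EuclideanSpace ℝ (Fin d),
      (∫⁻ s : ℝ,
          (‖∑' gh : {q : (Fin d → ℤ) × (Fin d → ℤ) // q ≠ 0},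
              oscInt d χ₀ Φ lam L s a b ξ ζ gh.1.1 gh.1.2‖₊ : ℝ≥0∞))
        ≤ ENNReal.ofReal (C * D * lam ^ (2 * (d : ℝ)) * L ^ (-1 + 2 * η) *
            (1 + ‖ξ‖ + ‖ζ‖)) ∧
      (∫⁻ s : ℝ,
          (‖∑' gh : (Fin d → ℤ) × (Fin d → ℤ),
              oscInt d χ₀ Φ lam L s a b ξ ζ gh.1 gh.2‖₊ : ℝ≥0∞))
        ≤ ENNReal.ofReal (C * D * lam ^ (2 * (d : ℝ))) := by
  obtain ⟨M, hM⟩ := exists_cutoffBound hχs hχ0 (5 * d)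
  have hM0 : 0 ≤ M := (norm_nonneg _).trans (hM 0 (by simp) 0)
  have hT := termConst_nonneg hM0 d
  have hJ := japMass_nonneg
  refine ⟨1 / 2, by norm_num, fun η hη hη2 κ hκ => ?_⟩
  obtain ⟨K, hK, hlog⟩ := exists_log_pow_le (4 * (2 * d + 2)) (by omega) hη
  set C₁ := termConst d M * (64 ^ (2 * d) * (1 + K * (2 * κ) ^ (d + 2))) * japMass with hC₁
  set C₂ := termConst d M * (96 * κ) ^ (2 * d) * (48 * d * japMass) * K with hC₂
  have hC₁0 : 0 ≤ C₁ := by positivity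
  have hC₂0 : 0 ≤ C₂ := by positivity
  refine ⟨1 + 4 * C₁ + C₂, by linarith, ?_⟩
  intro L hCL lam hlam hlamlog D hD0 Φ hΦ hD hsupp a b ξ ζ
  have hL : 1 ≤ L := by linarith
  have hL0 : 0 < L := by linarith
  have hpow : lam ^ (2 * (d : ℝ)) = lam ^ (2 * d) := by
    rw [← Real.rpow_natCast]
    push_cast
    rfl
  have hlamK : lam ^ (2 * d + 2) ≤ K * L ^ (2 * η) := by
    refine le_trans ?_ (hlog L hL)
    rw [pow_mul]
    gcongr
  have hlamL : lam ^ (2 * d) ≤ K * L :=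
    calc lam ^ (2 * d) ≤ lam ^ (2 * d + 2) := pow_le_pow_right₀ hlam (by omega)
      _ ≤ K * L ^ (2 * η) := hlamK
      _ ≤ K * L ^ (1 : ℝ) := by
          gcongr
          linarith
      _ = K * L := by rw [Real.rpow_one]
  have hfull := lintegral_tsum_enorm_oscInt_le hd hχs hχ0 hM hlam hκ hL hK hD0 hlamL hΦ hD hsupp
    a b ξ ζ
  rw [← hC₁] at hfull
  simp only [hpow]
  refine ⟨?_, ?_⟩
  · refine (lintegral_mono (g := fun s =>
      ∑' q : {q : (Fin d → ℤ) × (Fin d → ℤ) // q ≠ 0},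
        ‖oscInt d χ₀ Φ lam L s a b ξ ζ q.1.1 q.1.2‖ₑ) fun s =>
      enorm_tsum_le_tsum_enorm).trans ?_
    by_cases hsmall : (∀ i, |ξ i| ≤ L / 4) ∧ ∀ i, |ζ i| ≤ L / 4
    · refine (lintegral_tsum_ne_zero_enorm_oscInt_le hd hχs hχ0 hM hlam hκ hL hD0 hΦ hD hsupp
        a b hsmall.1 hsmall.2).trans (ENNReal.ofReal_le_ofReal ?_)
      have h1 : lam ^ (2 * d + 2) / L ≤ K * L ^ (-1 + 2 * η) := by
        rw [Real.rpow_add hL0, Real.rpow_neg_one, div_le_iff₀ hL0]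
        refine hlamK.trans (le_of_eq ?_)
        field_simp
      calc _ ≤ termConst d M * (96 * κ) ^ (2 * d) * (48 * d * japMass) * D * lam ^ (2 * d) *
            (K * L ^ (-1 + 2 * η)) := by gcongr
        _ = C₂ * D * lam ^ (2 * d) * L ^ (-1 + 2 * η) * 1 := by rw [hC₂]; ring
        _ ≤ _ := by
            gcongr
            · linarith
            · linarith [norm_nonneg ξ, norm_nonneg ζ]
    · have hbig : L / 4 ≤ ‖ξ‖ + ‖ζ‖ := by
        by_contra! h
        refine hsmall ⟨fun i => ?_, fun i => ?_⟩
        · have := PiLp.norm_apply_le ξ i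
          rw [Real.norm_eq_abs] at this
          linarith [norm_nonneg ζ]
        · have := PiLp.norm_apply_le ζ i
          rw [Real.norm_eq_abs] at this
          linarith [norm_nonneg ξ]
      refine (lintegral_mono fun s => ENNReal.tsum_comp_le_tsum_of_injective
        Subtype.val_injective fun q : (Fin d → ℤ) × (Fin d → ℤ) =>
          ‖oscInt d χ₀ Φ lam L s a b ξ ζ q.1 q.2‖ₑ).trans
        (hfull.trans (ENNReal.ofReal_le_ofReal ?_))
      have h1 : L⁻¹ ≤ L ^ (-1 + 2 * η) := by
        rw [← Real.rpow_neg_one]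
        exact Real.rpow_le_rpow_of_exponent_le hL (by linarith)
      calc C₁ * D * lam ^ (2 * d) = (4 * C₁) * D * lam ^ (2 * d) * L⁻¹ * (L / 4) := by
            field_simp
        _ ≤ (1 + 4 * C₁ + C₂) * D * lam ^ (2 * d) * L ^ (-1 + 2 * η) * (1 + ‖ξ‖ + ‖ζ‖) := by
            gcongr
            · linarith
            · linarith
  · refine (lintegral_mono (g := fun s =>
      ∑' q : (Fin d → ℤ) × (Fin d → ℤ), ‖oscInt d χ₀ Φ lam L s a b ξ ζ q.1 q.2‖ₑ) fun s =>
      enorm_tsum_le_tsum_enorm).trans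
      (hfull.trans (ENNReal.ofReal_le_ofReal ?_))
    gcongr
    linarith
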